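/- Let p ∈ [1,∞] and q⃗ = (q₁,q₂,q₃) with q_j > 1 for each j and 2/p + 1/q̄ = 2, where 1/q̄ := 1/q₁+1/q₂+1/q₃. There exists a constant C, depending only on p and q⃗, such that for every ϱ > 0 and every u : ℝ³×(−2ϱ²,0) → ℝ³ that is smooth in the spatial variable, writing v := u − ū_{√2 ϱ} (where ū_{√2 ϱ}(t) is the average of u(·,t) over B(√2 ϱ)), one has ∬_{Q(ϱ)} |v|³ dx dt ≤ C · ‖v‖_{L^p_t L^{q⃗}_x(Q(ϱ))} · ‖∇u‖_{L²(Q(√2 ϱ))}^{2 − 2/p} · ‖v‖_{L^∞_t L²_x(Q(√2 ϱ))}^{2/p}. -/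

import Mathlib

open MeasureTheory ENNReal Set Metric Filter

noncomputable section

/-- Euclidean 3-space. -/
abbrev E3 : Type := EuclideanSpace ℝ (Fin 3)

/-- The point (x₁,x₂,x₃) of ℝ³. -/
def pt3 (x1 x2 x3 : ℝ) : E3 := (WithLp.equiv 2 (Fin 3 → ℝ)).symm ![x1, x2, x3]

/-- Anisotropic Lebesgue (quasi-)norm `‖f‖_{L^{q⃗}(Ω)}` with finite exponents:
iterated L^{q₁}, L^{q₂}, L^{q₃} norms in x₁, x₂, x₃ of f extended by 0 outside Ω. -/
def anisoNorm (q1 q2 q3 : ℝ) (Ω : Set E3) (f : E3 → ℝ) : ℝ≥0∞ :=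
  (∫⁻ x3 : ℝ, (∫⁻ x2 : ℝ, (∫⁻ x1 : ℝ,
      (ENNReal.ofReal |Ω.indicator f (pt3 x1 x2 x3)|) ^ q1) ^ (q2 / q1)) ^ (q3 / q2)) ^ (1 / q3)

/-- Partial derivative in the i-th coordinate direction. -/
def pd (i : Fin 3) (f : E3 → ℝ) (x : E3) : ℝ := fderiv ℝ f x (EuclideanSpace.single i 1)

/-- Laplacian. -/
def lap (f : E3 → ℝ) (x : E3) : ℝ := ∑ i : Fin 3, pd i (fun y => pd i f y) x

/-- Mixed norm `‖f‖_{L^p_t L^{q⃗}_x(Q(r))}`, time exponent `p ∈ [1,∞]`,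
where `Q(r) = B(r) × (−r²,0)`. -/
def mixedNorm (p : ℝ≥0∞) (q1 q2 q3 r : ℝ) (f : E3 → ℝ → ℝ) : ℝ≥0∞ :=
  if p = ∞ then
    essSup (fun t => anisoNorm q1 q2 q3 (ball (0 : E3) r) (fun x => f x t))
      (volume.restrict (Ioo (-(r^2)) 0))
  else
    (∫⁻ t in Ioo (-(r^2)) 0,
        (anisoNorm q1 q2 q3 (ball (0 : E3) r) (fun x => f x t)) ^ p.toReal) ^ (1 / p.toReal)

/-- `L²` norm of a scalar function over a set. -/
def l2On (s : Set E3) (g : E3 → ℝ) : ℝ≥0∞ :=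
  (∫⁻ x in s, (ENNReal.ofReal |g x|) ^ 2) ^ ((1:ℝ)/2)

namespace CubeAux

/-- weak type estimate -/
lemma weak_type (g : ℝ → ℝ≥0∞) (τ : ℝ) (hτ : 0 < τ) :
    volume {x : ℝ | ∃ R : ℝ, 0 < R ∧ ENNReal.ofReal (τ * R) < ∫⁻ y in closedBall x R, g y}
      ≤ ENNReal.ofReal (8 / τ) * ∫⁻ y, g y := by
  by_cases hg : ∫⁻ y, g y = ∞
  · rw [hg, ENNReal.mul_top (by simpa using hτ)]; exact le_top
  set t : Set (ℝ × ℝ) := {a | 0 < a.2 ∧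
    ENNReal.ofReal (τ * a.2) < ∫⁻ y in closedBall a.1 a.2, g y} with ht
  have hr : ∀ a ∈ t, a.2 ≤ (∫⁻ y, g y).toReal / τ := by
    rintro a ⟨h1, h2⟩
    have h3 := h2.le.trans (setLIntegral_le_lintegral _ _)
    rw [ENNReal.ofReal_le_iff_le_toReal hg] at h3
    rw [le_div_iff₀ hτ]; linarith
  obtain ⟨u, hut, hdisj, hcov⟩ := Vitali.exists_disjoint_subfamily_covering_enlargement_closedBall
    t (fun a => a.1) (fun a => a.2) _ hr 4 (by norm_num)
  have hcount : u.Countable := by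
    apply hdisj.countable_of_nonempty_interior
    intro a ha
    rw [interior_closedBall _ (hut ha).1.ne']
    exact nonempty_ball.2 (hut ha).1
  have hsub : {x : ℝ | ∃ R : ℝ, 0 < R ∧ ENNReal.ofReal (τ * R) < ∫⁻ y in closedBall x R, g y}
      ⊆ ⋃ b ∈ u, closedBall b.1 (4 * b.2) := by
    rintro x ⟨R, hR, h⟩
    obtain ⟨b, hb, hsb⟩ := hcov (x, R) ⟨hR, h⟩
    exact mem_biUnion hb (hsb (mem_closedBall_self hR.le))
  calc _ ≤ volume (⋃ b ∈ u, closedBall b.1 (4 * b.2)) := measure_mono hsub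
    _ ≤ ∑' b : u, volume (closedBall b.1.1 (4 * b.1.2)) := measure_biUnion_le _ hcount _
    _ ≤ ∑' b : u, ENNReal.ofReal (8 / τ) * ∫⁻ y in closedBall b.1.1 b.1.2, g y := by
        refine ENNReal.tsum_le_tsum fun b => ?_
        rw [Real.volume_closedBall]
        have := (hut b.2).2.le
        calc ENNReal.ofReal (2 * (4 * b.1.2)) = ENNReal.ofReal (8 / τ) * ENNReal.ofReal (τ * b.1.2) := by
              rw [← ENNReal.ofReal_mul (by positivity)]; congr 1; field_simp; ring
          _ ≤ _ := by gcongr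
    _ = ENNReal.ofReal (8 / τ) * ∑' b : u, ∫⁻ y in closedBall b.1.1 b.1.2, g y := ENNReal.tsum_mul_left
    _ = ENNReal.ofReal (8 / τ) * ∫⁻ y in ⋃ b ∈ u, closedBall b.1 b.2, g y := by
        rw [lintegral_biUnion hcount (fun _ _ => measurableSet_closedBall) hdisj]
    _ ≤ _ := by gcongr; exact Measure.restrict_le_self

/-- Hardy-Littlewood maximal function (rational radii). -/
def MF (g : ℝ → ℝ≥0∞) (x : ℝ) : ℝ≥0∞ :=
  ⨆ q : {q : ℚ // 0 < q}, ENNReal.ofReal (1 / (q : ℝ)) * ∫⁻ y in closedBall x (q : ℝ), g y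

lemma ball_avg_measurable (g : ℝ → ℝ≥0∞) (hg : Measurable g) (R : ℝ) :
    Measurable fun x => ∫⁻ y in closedBall x R, g y := by
  have : (fun x => ∫⁻ y in closedBall x R, g y) =
      fun x => ∫⁻ y, ({z : ℝ × ℝ | dist z.2 z.1 ≤ R}.indicator (fun z => g z.2)) (x, y) := by
    ext x
    rw [← lintegral_indicator measurableSet_closedBall]
    rfl
  rw [this]
  apply Measurable.lintegral_prod_right'
  apply Measurable.indicator (by fun_prop)
  exact measurableSet_le (by fun_prop) (by fun_prop)

lemma MF_measurable (g : ℝ → ℝ≥0∞) (hg : Measurable g) : Measurable (MF g) := by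
  unfold MF
  refine Measurable.iSup fun q => ?_
  exact (ball_avg_measurable g hg _).const_mul _

lemma le_MF (g : ℝ → ℝ≥0∞) (x R : ℝ) (hR : 0 < R) :
    ∫⁻ y in closedBall x R, g y ≤ ENNReal.ofReal (2 * R) * MF g x := by
  obtain ⟨q, h1, h2⟩ := exists_rat_btwn (show R < 2 * R by linarith)
  have hq : 0 < q := by exact_mod_cast hR.trans h1
  have hq' : (0:ℝ) < q := by exact_mod_cast hq
  have := le_iSup (fun q : {q : ℚ // 0 < q} =>
    ENNReal.ofReal (1 / (q : ℝ)) * ∫⁻ y in closedBall x (q : ℝ), g y) ⟨q, hq⟩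
  calc ∫⁻ y in closedBall x R, g y ≤ ∫⁻ y in closedBall x (q:ℝ), g y :=
        lintegral_mono_set (closedBall_subset_closedBall h1.le)
    _ = ENNReal.ofReal q * (ENNReal.ofReal (1 / (q : ℝ)) * ∫⁻ y in closedBall x (q : ℝ), g y) := by
        rw [← mul_assoc, ← ENNReal.ofReal_mul hq'.le]; field_simp; simp
    _ ≤ _ := by
        refine mul_le_mul' (ENNReal.ofReal_le_ofReal h2.le) this

lemma MF_level (g : ℝ → ℝ≥0∞) (hg : Measurable g) (τ : ℝ) (hτ : 0 < τ) :
    volume {x | ENNReal.ofReal τ < MF g x} ≤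
      ENNReal.ofReal (16 / τ) * ∫⁻ y, {y | ENNReal.ofReal (τ / 4) < g y}.indicator g y := by
  have hw := weak_type ({y | ENNReal.ofReal (τ / 4) < g y}.indicator g) (τ / 2) (by positivity)
  have : 8 / (τ / 2) = 16 / τ := by field_simp; norm_num
  rw [this] at hw
  refine le_trans (measure_mono ?_) hw
  intro x hx
  simp only [mem_ofPred_eq, MF, lt_iSup_iff] at hx
  obtain ⟨q, hq⟩ := hx
  have hq' : (0:ℝ) < q := by exact_mod_cast q.2
  refine ⟨q, hq', ?_⟩
  have h1 : ENNReal.ofReal (τ * q) < ∫⁻ y in closedBall x (q:ℝ), g y := by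
    have h0 : ENNReal.ofReal q ≠ 0 := by simpa using hq'
    have h3 := ENNReal.mul_lt_mul_right h0 ENNReal.ofReal_ne_top hq
    rw [← mul_assoc, ← ENNReal.ofReal_mul hq'.le, ← ENNReal.ofReal_mul hq'.le] at h3
    have h4 : (q:ℝ) * (1 / q) = 1 := by field_simp
    rw [h4] at h3
    simpa [mul_comm] using h3
  have h2 : ∫⁻ y in closedBall x (q:ℝ), g y ≤
      (∫⁻ y in closedBall x (q:ℝ), {y | ENNReal.ofReal (τ / 4) < g y}.indicator g y)
        + ENNReal.ofReal (τ / 2 * q) := by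
    calc ∫⁻ y in closedBall x (q:ℝ), g y ≤ ∫⁻ y in closedBall x (q:ℝ),
          ({y | ENNReal.ofReal (τ / 4) < g y}.indicator g y + ENNReal.ofReal (τ / 4)) := by
          refine lintegral_mono fun y => ?_
          by_cases hy : ENNReal.ofReal (τ / 4) < g y
          · rw [indicator_of_mem (by exact hy)]; exact le_self_add
          · rw [indicator_of_notMem (by exact hy)]; simpa using hy
      _ = _ := by
          rw [lintegral_add_right _ measurable_const]
          congr 1
          rw [lintegral_const, Measure.restrict_apply_univ, Real.volume_closedBall,
            ← ENNReal.ofReal_mul (by positivity)]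
          congr 1; ring
  by_contra hcon
  push Not at hcon
  have := h1.trans_le (h2.trans (add_le_add_left hcon _))
  rw [← ENNReal.ofReal_add (by positivity) (by positivity)] at this
  refine absurd this (not_lt.2 (ENNReal.ofReal_le_ofReal ?_))
  linarith

lemma lint_id (m : ℝ) : ∫⁻ τ in Ioo 0 m, ENNReal.ofReal (2 * τ) = ENNReal.ofReal m ^ 2 := by
  rcases le_or_gt m 0 with hm | hm
  · simp [Ioo_eq_empty (not_lt.2 hm), ENNReal.ofReal_of_nonpos hm]
  · rw [restrict_Ioo_eq_restrict_Ioc, ← ofReal_integral_eq_lintegral_ofReal,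
      ← intervalIntegral.integral_of_le hm.le]
    · rw [← ENNReal.ofReal_pow hm.le, intervalIntegral.integral_const_mul, integral_id]; congr 1; ring
    · exact (Continuous.integrableOn_Icc (by fun_prop)).mono_set Ioc_subset_Icc_self
    · filter_upwards [ae_restrict_mem measurableSet_Ioc] with τ hτ
      have := hτ.1
      simp only [Pi.zero_apply]; positivity

lemma sq_le_layer (m : ℝ≥0∞) :
    m ^ 2 ≤ ∫⁻ τ in Ioi (0:ℝ), ENNReal.ofReal (2 * τ) * {τ | ENNReal.ofReal τ < m}.indicator 1 τ := by
  have key : ∀ c : ℝ, ENNReal.ofReal c ≤ m → ENNReal.ofReal c ^ 2 ≤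
      ∫⁻ τ in Ioi (0:ℝ), ENNReal.ofReal (2 * τ) * {τ | ENNReal.ofReal τ < m}.indicator 1 τ := by
    intro c hc
    rw [← lint_id]
    calc _ = ∫⁻ τ in Ioo 0 c, ENNReal.ofReal (2 * τ) * {τ | ENNReal.ofReal τ < m}.indicator 1 τ := by
          refine setLIntegral_congr_fun measurableSet_Ioo fun τ hτ => ?_
          have : ENNReal.ofReal τ < m := lt_of_lt_of_le
            ((ENNReal.ofReal_lt_ofReal_iff (hτ.1.trans hτ.2)).2 hτ.2) hc
          simp [this]
      _ ≤ _ := lintegral_mono_set (fun τ hτ => hτ.1)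
  rcases eq_or_ne m ∞ with rfl | hm
  · rw [ENNReal.top_pow two_ne_zero]
    refine ENNReal.le_of_forall_nnreal_lt fun c hc => ?_
    have h1 := key (max 1 c) le_top
    refine le_trans ?_ h1
    rw [← ENNReal.ofReal_pow (by positivity)]
    rw [← ENNReal.ofReal_coe_nnreal]
    apply ENNReal.ofReal_le_ofReal
    nlinarith [le_max_left (1:ℝ) c, le_max_right (1:ℝ) c]
  · have := key m.toReal (by rw [ENNReal.ofReal_toReal hm])
    rwa [ENNReal.ofReal_toReal hm] at this

/-- L² bound of the maximal function -/
lemma MF_L2 (g : ℝ → ℝ≥0∞) (hg : Measurable g) :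
    ∫⁻ x, MF g x ^ 2 ≤ 128 * ∫⁻ x, g x ^ 2 := by
  have hM := MF_measurable g hg
  have hm1 : ∀ f : ℝ → ℝ≥0∞, Measurable f → MeasurableSet {z : ℝ × ℝ | ENNReal.ofReal z.2 < f z.1} :=
    fun f hf => measurableSet_lt (by fun_prop) (by fun_prop)
  calc ∫⁻ x, MF g x ^ 2
      ≤ ∫⁻ x, ∫⁻ τ in Ioi (0:ℝ), ENNReal.ofReal (2 * τ) *
          {z : ℝ × ℝ | ENNReal.ofReal z.2 < MF g z.1}.indicator 1 (x, τ) :=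
        lintegral_mono fun x => sq_le_layer _
    _ = ∫⁻ τ in Ioi (0:ℝ), ∫⁻ x, ENNReal.ofReal (2 * τ) *
          {z : ℝ × ℝ | ENNReal.ofReal z.2 < MF g z.1}.indicator 1 (x, τ) := by
        rw [lintegral_lintegral_swap]
        refine Measurable.aemeasurable ?_
        refine Measurable.mul (by fun_prop) ?_
        exact (measurable_one.indicator (hm1 _ hM))
    _ = ∫⁻ τ in Ioi (0:ℝ), ENNReal.ofReal (2 * τ) * volume {x | ENNReal.ofReal τ < MF g x} := by
        refine lintegral_congr fun τ => ?_
        rw [lintegral_const_mul' _ _ ENNReal.ofReal_ne_top]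
        congr 1
        rw [← lintegral_indicator_one (measurableSet_lt measurable_const hM)]
        rfl
    _ ≤ ∫⁻ τ in Ioi (0:ℝ), 32 * ∫⁻ y, {y | ENNReal.ofReal (τ / 4) < g y}.indicator g y := by
        refine setLIntegral_mono' measurableSet_Ioi fun τ hτ => ?_
        have hτ : 0 < τ := hτ
        refine (mul_le_mul_right (MF_level g hg τ hτ) _).trans ?_
        rw [← mul_assoc, ← ENNReal.ofReal_mul (by positivity)]
        have : 2 * τ * (16 / τ) = 32 := by field_simp; norm_num
        rw [this]; simp
    _ = 32 * ∫⁻ τ in Ioi (0:ℝ), ∫⁻ y, {y | ENNReal.ofReal (τ / 4) < g y}.indicator g y := by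
        rw [lintegral_const_mul' _ _ (by simp)]
    _ = 32 * ∫⁻ y, ∫⁻ τ in Ioi (0:ℝ), {y | ENNReal.ofReal (τ / 4) < g y}.indicator g y := by
        rw [lintegral_lintegral_swap]
        refine Measurable.aemeasurable ?_
        have : Measurable ({z : ℝ × ℝ | ENNReal.ofReal (z.1 / 4) < g z.2}.indicator
          (fun z => g z.2)) := by
          apply Measurable.indicator (by fun_prop)
          exact measurableSet_lt (by fun_prop) (by fun_prop)
        exact this
    _ ≤ 32 * ∫⁻ y, 4 * g y ^ 2 := by
        gcongr with y
        have : ∀ τ, {y | ENNReal.ofReal (τ / 4) < g y}.indicator g y =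
          g y * {τ | ENNReal.ofReal (τ / 4) < g y}.indicator 1 τ := by
          intro τ
          by_cases h : ENNReal.ofReal (τ / 4) < g y <;> simp [h]
        simp_rw [this]
        have hme : MeasurableSet {τ | ENNReal.ofReal (τ / 4) < g y} :=
            measurableSet_lt (by fun_prop) measurable_const
        rw [lintegral_const_mul _ (measurable_one.indicator hme), lintegral_indicator_one hme, sq,
          mul_left_comm]
        gcongr
        rw [Measure.restrict_apply hme]
        rcases eq_or_ne (g y) ∞ with h | h
        · rw [h]; simp
        · calc _ ≤ volume (Ioo 0 (4 * (g y).toReal)) := by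
                refine measure_mono fun τ hτ => ⟨hτ.2, ?_⟩
                have h1 : ENNReal.ofReal (τ / 4) < g y := hτ.1
                have h2 : 0 < τ := hτ.2
                rw [ENNReal.ofReal_lt_iff_lt_toReal (by positivity) h] at h1
                linarith
            _ = _ := by
              rw [Real.volume_Ioo, sub_zero, ENNReal.ofReal_mul (by norm_num),
                ENNReal.ofReal_toReal h]; simp
    _ = _ := by
        rw [lintegral_const_mul' _ _ (by simp), ← mul_assoc]; norm_num

end CubeAux

namespace CubeAux

lemma lint_Ioi (c a : ℝ) (hc : 0 < c) (ha : a < -1) :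
    ∫⁻ R in Ioi c, ENNReal.ofReal (R ^ a) = ENNReal.ofReal (-c ^ (a + 1) / (a + 1)) := by
  rw [← ofReal_integral_eq_lintegral_ofReal, integral_Ioi_rpow_of_lt ha hc]
  · exact integrableOn_Ioi_rpow_of_lt ha hc
  · filter_upwards [ae_restrict_mem measurableSet_Ioi] with R hR
    exact Real.rpow_nonneg (hc.trans hR).le _

lemma lint_Ioc (c a : ℝ) (hc : 0 < c) (ha : -1 < a) :
    ∫⁻ R in Ioc 0 c, ENNReal.ofReal (R ^ a) = ENNReal.ofReal (c ^ (a + 1) / (a + 1)) := by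
  rw [← ofReal_integral_eq_lintegral_ofReal, ← intervalIntegral.integral_of_le hc.le,
    integral_rpow (Or.inl ha), Real.zero_rpow (by linarith), sub_zero]
  · exact (intervalIntegrable_iff_integrableOn_Ioc_of_le hc.le).1
      (intervalIntegral.intervalIntegrable_rpow' ha)
  · filter_upwards [ae_restrict_mem measurableSet_Ioc] with R hR
    exact Real.rpow_nonneg hR.1.le _

/-- one-dimensional kernel -/
def ker (b z : ℝ) : ℝ≥0∞ := ENNReal.ofReal |z| ^ (-b)

lemma ker_measurable (b : ℝ) : Measurable (ker b) := by unfold ker; fun_prop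

lemma ker_eq (b z : ℝ) (hz : z ≠ 0) : ker b z = ENNReal.ofReal (|z| ^ (-b)) := by
  rw [ker, ENNReal.ofReal_rpow_of_pos (abs_pos.2 hz)]

/-- layer cake of the kernel -/
lemma ker_layer (b z : ℝ) (hb : 0 < b) (hz : z ≠ 0) :
    ker b z = ENNReal.ofReal b * ∫⁻ R in Ioi |z|, ENNReal.ofReal (R ^ (-b - 1)) := by
  rw [lint_Ioi _ _ (abs_pos.2 hz) (by linarith), ker_eq b z hz, ← ENNReal.ofReal_mul hb.le]
  congr 1
  have : -b - 1 + 1 = -b := by ring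
  rw [this]; field_simp

lemma T_layer (b : ℝ) (hb : 0 < b) (g : ℝ → ℝ≥0∞) (hg : Measurable g) (x : ℝ) :
    ∫⁻ y, ker b (x - y) * g y ≤
      ENNReal.ofReal b * ∫⁻ R in Ioi (0:ℝ), ENNReal.ofReal (R ^ (-b - 1)) *
        ∫⁻ y in closedBall x R, g y := by
  have hms : MeasurableSet {z : ℝ × ℝ | |x - z.1| < z.2} :=
    measurableSet_lt (by fun_prop) (by fun_prop)
  have hmeas : Measurable fun z : ℝ × ℝ => {z : ℝ × ℝ | |x - z.1| < z.2}.indicator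
      (fun z => ENNReal.ofReal (z.2 ^ (-b - 1)) * g z.1) z := by
    apply Measurable.indicator _ hms
    fun_prop
  calc ∫⁻ y, ker b (x - y) * g y
      = ∫⁻ y, ENNReal.ofReal b * ∫⁻ R in Ioi (0:ℝ), {z : ℝ × ℝ | |x - z.1| < z.2}.indicator
          (fun z => ENNReal.ofReal (z.2 ^ (-b - 1)) * g z.1) (y, R) := by
        refine lintegral_congr_ae ?_
        have : ∀ᵐ y : ℝ, y ≠ x := by simp [ae_iff, measure_singleton]
        filter_upwards [this] with y hy
        rw [ker_layer b _ hb (sub_ne_zero.2 hy.symm), mul_assoc]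
        congr 1
        rw [← lintegral_mul_const _ (by fun_prop), ← lintegral_indicator measurableSet_Ioi,
          ← lintegral_indicator measurableSet_Ioi]
        refine lintegral_congr fun R => ?_
        by_cases h : |x - y| < R
        · have h0 : 0 < R := (abs_nonneg _).trans_lt h
          simp [h, h0]
        · by_cases h0 : 0 < R <;> simp [h, h0]
    _ = ENNReal.ofReal b * ∫⁻ R in Ioi (0:ℝ), ∫⁻ y, {z : ℝ × ℝ | |x - z.1| < z.2}.indicator
          (fun z => ENNReal.ofReal (z.2 ^ (-b - 1)) * g z.1) (y, R) := by
        rw [lintegral_const_mul' _ _ ENNReal.ofReal_ne_top, lintegral_lintegral_swap]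
        exact hmeas.aemeasurable
    _ ≤ _ := by
        refine mul_le_mul_right ?_ _
        refine lintegral_mono fun R => ?_
        rw [← lintegral_const_mul _ hg, ← lintegral_indicator measurableSet_closedBall]
        refine lintegral_mono fun y => ?_
        by_cases h : |x - y| < R
        · have : y ∈ closedBall x R := by
            rw [mem_closedBall, dist_comm, Real.dist_eq]; exact h.le
          simp [h, this]
        · simp [h]

lemma ball_CS (g : ℝ → ℝ≥0∞) (hg : Measurable g) (x R : ℝ) (hR : 0 < R) :
    ∫⁻ y in closedBall x R, g y ≤ ENNReal.ofReal (2 * R) ^ (1/2:ℝ) * (∫⁻ y, g y ^ 2) ^ (1/2:ℝ) := by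
  have h := ENNReal.lintegral_mul_le_Lp_mul_Lq (volume.restrict (closedBall x R))
    Real.HolderConjugate.two_two (f := fun _ => 1) (g := g) (by fun_prop) (by fun_prop)
  simp only [Pi.mul_apply, one_mul, ENNReal.rpow_two, one_pow, lintegral_const,
    Measure.restrict_apply_univ, Real.volume_closedBall] at h
  refine h.trans ?_
  gcongr
  exact Measure.restrict_le_self

/-- Hedberg type bound with free parameter -/
lemma T_le_rho (b : ℝ) (hb : 1/2 < b) (hb1 : b < 1) (g : ℝ → ℝ≥0∞) (hg : Measurable g) (x ρ : ℝ)
    (hρ : 0 < ρ) :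
    ∫⁻ y, ker b (x - y) * g y ≤
      ENNReal.ofReal (2 * ρ ^ (1 - b) / (1 - b)) * MF g x
      + ENNReal.ofReal (2 * ρ ^ (1/2 - b) / (b - 1/2)) * (∫⁻ y, g y ^ 2) ^ (1/2:ℝ) := by
  refine (T_layer b (by linarith) g hg x).trans ?_
  rw [← Ioc_union_Ioi_eq_Ioi hρ.le, lintegral_union measurableSet_Ioi
    (Set.Ioc_disjoint_Ioi le_rfl)]
  have h1 : ∫⁻ R in Ioc 0 ρ, ENNReal.ofReal (R ^ (-b - 1)) * ∫⁻ y in closedBall x R, g y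
      ≤ ENNReal.ofReal (2 * ρ ^ (1 - b) / (1 - b)) * MF g x := by
    calc _ ≤ ∫⁻ R in Ioc 0 ρ, ENNReal.ofReal (R ^ (-b)) * (2 * MF g x) := by
          refine setLIntegral_mono' measurableSet_Ioc fun R hR => ?_
          have hR0 : 0 < R := hR.1
          refine (mul_le_mul_right (le_MF g x R hR0) _).trans (le_of_eq ?_)
          rw [← ENNReal.ofReal_ofNat 2, ← mul_assoc, ← mul_assoc,
            ← ENNReal.ofReal_mul (by positivity), ← ENNReal.ofReal_mul (by positivity)]
          congr 2
          rw [Real.rpow_sub_one hR0.ne']; field_simp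
      _ = _ := by
          rw [lintegral_mul_const _ (by fun_prop), lint_Ioc _ _ hρ (by linarith), ← mul_assoc,
            ← ENNReal.ofReal_ofNat 2, ← ENNReal.ofReal_mul (by
              rw [neg_add_eq_sub]; have : 0 < 1 - b := by linarith
              positivity), neg_add_eq_sub]
          congr 2; ring
  have h2 : ∫⁻ R in Ioi ρ, ENNReal.ofReal (R ^ (-b - 1)) * ∫⁻ y in closedBall x R, g y
      ≤ ENNReal.ofReal (2 * ρ ^ (1/2 - b) / (b - 1/2)) * (∫⁻ y, g y ^ 2) ^ (1/2:ℝ) := by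
    calc _ ≤ ∫⁻ R in Ioi ρ, ENNReal.ofReal (R ^ (-b - 1/2)) *
              (2 * (∫⁻ y, g y ^ 2) ^ (1/2:ℝ)) := by
          refine setLIntegral_mono' measurableSet_Ioi fun R hR => ?_
          have hR0 : 0 < R := hρ.trans hR
          refine (mul_le_mul_right (ball_CS g hg x R hR0) _).trans ?_
          rw [← mul_assoc, ← mul_assoc]
          refine mul_le_mul_left ?_ _
          rw [ENNReal.ofReal_rpow_of_pos (by positivity), ← ENNReal.ofReal_mul (by positivity),
            ← ENNReal.ofReal_ofNat 2, ← ENNReal.ofReal_mul (by positivity)]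
          apply ENNReal.ofReal_le_ofReal
          rw [Real.mul_rpow (by norm_num) hR0.le]
          have e1 : R ^ (-b - 1) * R ^ (1/2:ℝ) = R ^ (-b - 1/2) := by
            rw [← Real.rpow_add hR0]; congr 1; ring
          have e2 : (2:ℝ) ^ (1/2:ℝ) ≤ 2 := by
            calc (2:ℝ) ^ (1/2:ℝ) ≤ 2 ^ (1:ℝ) :=
                  Real.rpow_le_rpow_of_exponent_le (by norm_num) (by norm_num)
              _ = 2 := Real.rpow_one _
          calc R ^ (-b - 1) * (2 ^ (1/2:ℝ) * R ^ (1/2:ℝ)) = R ^ (-b - 1/2) * 2 ^ (1/2:ℝ) := by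
                rw [← e1]; ring
            _ ≤ _ := by gcongr
      _ = _ := by
          rw [lintegral_mul_const _ (by fun_prop), lint_Ioi _ _ hρ (by linarith), ← mul_assoc,
            ← ENNReal.ofReal_ofNat 2, ← ENNReal.ofReal_mul']
          · congr 2
            have : -b - 1/2 + 1 = 1/2 - b := by ring
            rw [this]
            have h3 : b - 1/2 ≠ 0 := by linarith
            have h4 : 1/2 - b ≠ 0 := by linarith
            rw [div_mul_eq_mul_div, div_eq_div_iff h4 h3]; ring
          · norm_num
  have hb1' : ENNReal.ofReal b ≤ 1 := by
    rw [← ENNReal.ofReal_one]; exact ENNReal.ofReal_le_ofReal hb1.le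
  refine (mul_le_mul' hb1' (add_le_add h1 h2)).trans ?_
  rw [one_mul]

/-- Hedberg pointwise bound. -/
lemma hedberg (b : ℝ) (hb : 1/2 < b) (hb1 : b < 1) : ∃ C : ℝ, 0 < C ∧ ∀ (g : ℝ → ℝ≥0∞),
    Measurable g → (∫⁻ y, g y ^ 2) ≠ 0 → (∫⁻ y, g y ^ 2) ≠ ∞ → ∀ x : ℝ,
    ∫⁻ y, ker b (x - y) * g y ≤
      ENNReal.ofReal C * MF g x ^ (2 * b - 1) * (∫⁻ y, g y ^ 2) ^ (1 - b) := by
  have hb2 : 0 < 1 - b := by linarith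
  have hb3 : 0 < b - 1/2 := by linarith
  refine ⟨2 / (1 - b) + 2 / (b - 1/2), by positivity, ?_⟩
  intro g hg h0 htop x
  set G2 := ∫⁻ y, g y ^ 2 with hG2
  have hC : ENNReal.ofReal (2 / (1 - b) + 2 / (b - 1/2)) ≠ 0 := by
    have : 0 < 2 / (1 - b) + 2 / (b - 1/2) := by positivity
    exact (ENNReal.ofReal_pos.2 this).ne'
  have hGp : G2 ^ (1 - b) ≠ 0 := by
    exact (ENNReal.rpow_pos (pos_iff_ne_zero.2 h0) htop).ne'
  rcases eq_or_ne (MF g x) ∞ with hM | hM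
  · rw [hM, ENNReal.top_rpow_of_pos (by linarith), ENNReal.mul_top hC, ENNReal.top_mul hGp]
    exact le_top
  rcases eq_or_ne (MF g x) 0 with hM0 | hM0
  · refine le_trans ?_ zero_le
    refine (T_layer b (by linarith) g hg x).trans ?_
    rw [setLIntegral_congr_fun (g := fun _ => 0) measurableSet_Ioi]
    · simp
    · intro R hR
      have := le_MF g x R hR
      rw [hM0, mul_zero, nonpos_iff_eq_zero] at this
      simp [this]
  · set m := (MF g x).toReal with hm
    set G := G2.toReal with hG
    have hmp : 0 < m := ENNReal.toReal_pos hM0 hM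
    have hGp : 0 < G := ENNReal.toReal_pos h0 htop
    have e1 : MF g x = ENNReal.ofReal m := (ENNReal.ofReal_toReal hM).symm
    have e2 : G2 = ENNReal.ofReal G := (ENNReal.ofReal_toReal htop).symm
    refine (T_le_rho b hb hb1 g hg x (G / m ^ 2) (by positivity)).trans ?_
    rw [← hG2, e1, e2, ENNReal.ofReal_rpow_of_pos hmp, ENNReal.ofReal_rpow_of_pos hGp,
      ENNReal.ofReal_rpow_of_pos hGp, ← ENNReal.ofReal_mul (by positivity),
      ← ENNReal.ofReal_mul (by positivity), ← ENNReal.ofReal_mul (by positivity),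
      ← ENNReal.ofReal_mul (by positivity), ← ENNReal.ofReal_add (by positivity) (by positivity)]
    apply ENNReal.ofReal_le_ofReal
    apply le_of_eq
    have p1 : (G / m ^ 2) ^ (1 - b) * m = m ^ (2 * b - 1) * G ^ (1 - b) := by
      rw [Real.div_rpow hGp.le (by positivity), ← Real.rpow_natCast m 2, ← Real.rpow_mul hmp.le]
      have : m ^ (2 * b - 1) = m / m ^ ((2:ℕ) * (1 - b)) := by
        have h2 : m ^ ((2:ℕ) * (1 - b)) ≠ 0 := (Real.rpow_pos_of_pos hmp _).ne'
        rw [eq_div_iff h2, ← Real.rpow_add hmp]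
        conv_rhs => rw [← Real.rpow_one m]
        congr 1; push_cast; ring
      rw [this]; field_simp
    have p2 : (G / m ^ 2) ^ (1/2 - b) * G ^ (1/2:ℝ) = m ^ (2 * b - 1) * G ^ (1 - b) := by
      rw [Real.div_rpow hGp.le (by positivity), ← Real.rpow_natCast m 2, ← Real.rpow_mul hmp.le]
      have h1 : m ^ (2 * b - 1) = 1 / m ^ ((2:ℕ) * (1/2 - b)) := by
        have h2 : m ^ ((2:ℕ) * (1/2 - b)) ≠ 0 := (Real.rpow_pos_of_pos hmp _).ne'
        rw [eq_div_iff h2, ← Real.rpow_add hmp]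
        conv_rhs => rw [← Real.rpow_zero m]
        congr 1; push_cast; ring
      have h2 : G ^ (1 - b) = G ^ (1/2 - b) * G ^ (1/2:ℝ) := by
        rw [← Real.rpow_add hGp]; congr 1; ring
      rw [h1, h2]; field_simp
    calc _ = 2 / (1 - b) * ((G / m ^ 2) ^ (1 - b) * m)
        + 2 / (b - 1/2) * ((G / m ^ 2) ^ (1/2 - b) * G ^ (1/2:ℝ)) := by ring
      _ = _ := by rw [p1, p2]; ring

/-- One-dimensional Hardy-Littlewood-Sobolev. -/
lemma hls (r : ℝ) (hr : 2 < r) : ∃ C : ℝ, 0 < C ∧ ∀ (g : ℝ → ℝ≥0∞), Measurable g →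
    (∫⁻ x, (∫⁻ y, ker (1/2 + 1/r) (x - y) * g y) ^ r) ^ (1/r)
      ≤ ENNReal.ofReal C * (∫⁻ y, g y ^ 2) ^ (1/2:ℝ) := by
  have hr0 : 0 < r := by linarith
  have hr2 : 1 / r < 1/2 := by
    rw [div_lt_div_iff₀ hr0 (by norm_num)]; linarith
  have hr3 : 0 < 1 / r := by positivity
  obtain ⟨C, hC, h⟩ := hedberg (1/2 + 1/r) (by linarith) (by linarith)
  refine ⟨C * 128 ^ (1/r), by positivity, fun g hg => ?_⟩
  rcases eq_or_ne (∫⁻ y, g y ^ 2) 0 with h0 | h0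
  · have h1 : ∀ᵐ y, g y = 0 := by
      rw [lintegral_eq_zero_iff (by fun_prop)] at h0
      filter_upwards [h0] with y hy
      simpa using hy
    have h2 : ∀ x, ∫⁻ y, ker (1/2 + 1/r) (x - y) * g y = 0 := by
      intro x
      rw [lintegral_congr_ae (g := fun _ => 0)]
      · simp
      · filter_upwards [h1] with y hy
        simp [hy]
    simp_rw [h2]
    simp [hr0]
  rcases eq_or_ne (∫⁻ y, g y ^ 2) ∞ with ht | ht
  · rw [ht, ENNReal.top_rpow_of_pos (by norm_num), ENNReal.mul_top]
    · exact le_top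
    · simp; positivity
  set G2 := ∫⁻ y, g y ^ 2 with hG2
  have hne : G2 ^ (r / 2 - 1) ≠ ∞ := by
    apply ENNReal.rpow_ne_top_of_ne_zero h0 ht
  calc (∫⁻ x, (∫⁻ y, ker (1/2 + 1/r) (x - y) * g y) ^ r) ^ (1/r)
      ≤ (∫⁻ x, ENNReal.ofReal C ^ r * G2 ^ (r / 2 - 1) * MF g x ^ 2) ^ (1/r) := by
        gcongr with x
        refine (ENNReal.rpow_le_rpow (h g hg h0 ht x) hr0.le).trans (le_of_eq ?_)
        rw [ENNReal.mul_rpow_of_nonneg _ _ hr0.le, ENNReal.mul_rpow_of_nonneg _ _ hr0.le,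
          ← ENNReal.rpow_mul, ← ENNReal.rpow_mul]
        have a1 : (2 * (1 / 2 + 1 / r) - 1) * r = 2 := by field_simp; ring
        have a2 : (1 - (1 / 2 + 1 / r)) * r = r / 2 - 1 := by field_simp; ring
        rw [a1, a2, ENNReal.rpow_two]; ring
    _ ≤ (ENNReal.ofReal C ^ r * G2 ^ (r / 2 - 1) * (128 * G2)) ^ (1/r) := by
        rw [lintegral_const_mul' _ _ (ENNReal.mul_ne_top (by
          apply ENNReal.rpow_ne_top_of_nonneg hr0.le ENNReal.ofReal_ne_top) hne)]
        gcongr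
        exact MF_L2 g hg
    _ = (ENNReal.ofReal C ^ r * 128 * G2 ^ (r / 2)) ^ (1/r) := by
        congr 1
        have : G2 ^ (r / 2) = G2 ^ (r / 2 - 1) * G2 := by
          conv_rhs => rw [← ENNReal.rpow_one G2, ← ENNReal.rpow_mul, one_mul]
          rw [← ENNReal.rpow_add _ _ h0 ht]; congr 1; ring
        rw [this]; ring
    _ = _ := by
        rw [ENNReal.mul_rpow_of_nonneg _ _ hr3.le, ENNReal.mul_rpow_of_nonneg _ _ hr3.le,
          ← ENNReal.rpow_mul, ← ENNReal.rpow_mul, ENNReal.ofReal_mul hC.le,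
          ← ENNReal.ofReal_rpow_of_pos (by norm_num)]
        have a1 : r * (1 / r) = 1 := by field_simp
        have a2 : r / 2 * (1 / r) = 1 / 2 := by field_simp
        rw [a1, a2, ENNReal.rpow_one]; simp

end CubeAux

namespace CubeAux

lemma minkowski {α β : Type*} [MeasurableSpace α] [MeasurableSpace β] (μ : Measure α)
    (ν : Measure β) [SigmaFinite μ] [SFinite ν] (r : ℝ) (hr : 1 < r) (f : α → β → ℝ≥0∞)
    (hf : Measurable (fun z : α × β => f z.1 z.2)) :
    (∫⁻ x, (∫⁻ y, f x y ∂ν) ^ r ∂μ) ^ (1/r) ≤ ∫⁻ y, (∫⁻ x, f x y ^ r ∂μ) ^ (1/r) ∂ν := by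
  have hr0 : 0 < r := by linarith
  set F : α → ℝ≥0∞ := fun x => ∫⁻ y, f x y ∂ν with hF
  have hFm : Measurable F := hf.lintegral_prod_right'
  set A := ∫⁻ y, (∫⁻ x, f x y ^ r ∂μ) ^ (1/r) ∂ν with hA
  set Fn : ℕ → α → ℝ≥0∞ := fun n => (spanningSets μ n).indicator (fun x => min (F x) n) with hFn
  have hFnm : ∀ n, Measurable (Fn n) := fun n =>
    (hFm.min measurable_const).indicator (measurableSet_spanningSets μ n)
  have hFnF : ∀ n x, Fn n x ≤ F x := by
    intro n x
    by_cases h : x ∈ spanningSets μ n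
    · simp [hFn, h]
    · simp [hFn, h]
  have hmono : Monotone Fn := by
    intro m n hmn x
    by_cases h : x ∈ spanningSets μ m
    · have h' := monotone_spanningSets μ hmn h
      simp only [hFn, indicator_of_mem h, indicator_of_mem h']
      gcongr
    · simp [hFn, h]
  have hsup : ∀ x, ⨆ n, Fn n x = F x := by
    intro x
    apply le_antisymm (iSup_le fun n => hFnF n x)
    refine le_of_forall_lt fun c hc => ?_
    obtain ⟨n, hn⟩ := ENNReal.exists_nat_gt (ne_top_of_lt hc)
    have hx : x ∈ ⋃ n, spanningSets μ n := by rw [iUnion_spanningSets]; trivial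
    obtain ⟨m, hm⟩ := mem_iUnion.1 hx
    rw [lt_iSup_iff]
    refine ⟨max m n, ?_⟩
    have := monotone_spanningSets μ (le_max_left m n) hm
    simp only [hFn, indicator_of_mem this, lt_min_iff]
    refine ⟨hc, hn.trans_le ?_⟩
    exact_mod_cast le_max_right m n
  have hfin : ∀ n, ∫⁻ x, Fn n x ^ r ∂μ ≠ ∞ := by
    intro n
    refine ne_of_lt (lt_of_le_of_lt (lintegral_mono (g := (spanningSets μ n).indicator
      (fun _ => (n:ℝ≥0∞) ^ r)) fun x => ?_) ?_)
    · by_cases h : x ∈ spanningSets μ n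
      · simp only [hFn, indicator_of_mem h]
        gcongr
        exact min_le_right _ _
      · simp [hFn, h, hr0]
    · rw [lintegral_indicator_const (measurableSet_spanningSets μ n)]
      exact ENNReal.mul_lt_top (ENNReal.rpow_lt_top_of_nonneg hr0.le (by simp))
        (measure_spanningSets_lt_top μ n)
  have hconj : r.HolderConjugate (r / (r - 1)) := Real.HolderConjugate.conjExponent hr
  have hX : ∀ n, ∫⁻ x, Fn n x ^ r ∂μ ≤ A ^ r := by
    intro n
    set X := ∫⁻ x, Fn n x ^ r ∂μ with hXdef
    have h1 : X ≤ A * X ^ (1 / (r / (r - 1))) := by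
      calc X ≤ ∫⁻ x, F x * Fn n x ^ (r - 1) ∂μ := by
            refine lintegral_mono fun x => ?_
            have : Fn n x ^ r = Fn n x ^ (1:ℝ) * Fn n x ^ (r - 1) := by
              rw [← ENNReal.rpow_add_of_nonneg _ _ (by norm_num) (by linarith)]; congr 1; ring
            rw [this, ENNReal.rpow_one]
            gcongr
            exact hFnF n x
        _ = ∫⁻ x, ∫⁻ y, f x y * Fn n x ^ (r - 1) ∂ν ∂μ := by
            refine lintegral_congr fun x => ?_
            rw [lintegral_mul_const _ (by fun_prop)]
        _ = ∫⁻ y, ∫⁻ x, f x y * Fn n x ^ (r - 1) ∂μ ∂ν := by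
            rw [lintegral_lintegral_swap]
            have := hFnm n
            exact (hf.mul (by fun_prop)).aemeasurable
        _ ≤ ∫⁻ y, (∫⁻ x, f x y ^ r ∂μ) ^ (1/r) * X ^ (1 / (r / (r - 1))) ∂ν := by
            refine lintegral_mono fun y => ?_
            have hm := hFnm n
            have := ENNReal.lintegral_mul_le_Lp_mul_Lq μ hconj (f := fun x => f x y)
              (g := fun x => Fn n x ^ (r - 1)) (by fun_prop) (by fun_prop)
            refine this.trans (le_of_eq ?_)
            congr 2
            refine lintegral_congr fun x => ?_
            rw [← ENNReal.rpow_mul]; congr 1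
            have : r - 1 ≠ 0 := by linarith
            field_simp
        _ = _ := by
            rw [lintegral_mul_const]
            have : Measurable fun y => ∫⁻ x, f x y ^ r ∂μ :=
              Measurable.lintegral_prod_left' (f := fun z : α × β => f z.1 z.2 ^ r)
                (hf.pow_const r)
            exact this.pow_const _
    rcases eq_or_ne X 0 with h0 | h0
    · rw [h0]; exact zero_le
    · have h2 : X ^ (1/r) * X ^ (1 / (r / (r - 1))) = X := by
        rw [← ENNReal.rpow_add _ _ h0 (hfin n)]
        have : 1 / r + 1 / (r / (r - 1)) = 1 := by
          have : r - 1 ≠ 0 := by linarith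
          field_simp; ring
        rw [this, ENNReal.rpow_one]
      have h3 : X ^ (1/r) ≤ A := by
        rw [← ENNReal.mul_le_mul_iff_left (c := X ^ (1 / (r / (r - 1)))), h2]
        · exact h1
        · exact (ENNReal.rpow_pos (pos_iff_ne_zero.2 h0) (hfin n)).ne'
        · exact ENNReal.rpow_ne_top_of_ne_zero h0 (hfin n)
      calc X = (X ^ (1/r)) ^ r := by rw [← ENNReal.rpow_mul]; simp [hr0.ne']
        _ ≤ _ := by gcongr
  have : ∫⁻ x, F x ^ r ∂μ ≤ A ^ r := by
    have e : ∀ x, F x ^ r = ⨆ n, Fn n x ^ r := by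
      intro x
      rw [← hsup x]
      exact (ENNReal.orderIsoRpow r hr0).map_iSup _
    simp_rw [e]
    rw [lintegral_iSup (fun n => (hFnm n).pow_const r)]
    · exact iSup_le hX
    · intro m n hmn x
      exact ENNReal.rpow_le_rpow (hmono hmn x) hr0.le
  calc _ ≤ (A ^ r) ^ (1/r) := by gcongr
    _ = A := by rw [← ENNReal.rpow_mul]; simp [hr0.ne']

/-- weighted Minkowski over ℝ -/
lemma minkowski_w (r : ℝ) (hr : 1 < r) (k : ℝ → ℝ≥0∞) (hk : Measurable k) (f : ℝ → ℝ → ℝ≥0∞)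
    (hf : Measurable (fun z : ℝ × ℝ => f z.1 z.2)) :
    (∫⁻ x, (∫⁻ y, k y * f x y) ^ r) ^ (1/r) ≤ ∫⁻ y, k y * (∫⁻ x, f x y ^ r) ^ (1/r) := by
  have hr0 : 0 < r := by linarith
  refine (minkowski volume volume r hr (fun x y => k y * f x y) (by fun_prop)).trans (le_of_eq ?_)
  refine lintegral_congr fun y => ?_
  have : ∀ x, (k y * f x y) ^ r = k y ^ r * f x y ^ r := fun x =>
    ENNReal.mul_rpow_of_nonneg _ _ hr0.le
  simp_rw [this]
  rw [lintegral_const_mul _ (by fun_prop), ENNReal.mul_rpow_of_nonneg _ _ (by positivity),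
    ← ENNReal.rpow_mul]
  simp [hr0.ne']

/-- iterated norm -/
def mix (r1 r2 r3 : ℝ) (F : ℝ → ℝ → ℝ → ℝ≥0∞) : ℝ≥0∞ :=
  (∫⁻ x3, ((∫⁻ x2, ((∫⁻ x1, F x1 x2 x3 ^ r1) ^ (1/r1)) ^ r2) ^ (1/r2)) ^ r3) ^ (1/r3)

/-- product-kernel potential -/
def TT (b1 b2 b3 : ℝ) (g : ℝ → ℝ → ℝ → ℝ≥0∞) (x1 x2 x3 : ℝ) : ℝ≥0∞ :=
  ∫⁻ y3, ker b3 (x3 - y3) * ∫⁻ y2, ker b2 (x2 - y2) * ∫⁻ y1, ker b1 (x1 - y1) * g y1 y2 y3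

lemma TT_bound (r1 r2 r3 : ℝ) (h1 : 2 < r1) (h2 : 2 < r2) (h3 : 2 < r3) : ∃ C : ℝ, 0 < C ∧
    ∀ g : ℝ → ℝ → ℝ → ℝ≥0∞, Measurable (fun z : ℝ × ℝ × ℝ => g z.1 z.2.1 z.2.2) →
    mix r1 r2 r3 (TT (1/2+1/r1) (1/2+1/r2) (1/2+1/r3) g)
      ≤ ENNReal.ofReal C * (∫⁻ x3, ∫⁻ x2, ∫⁻ x1, g x1 x2 x3 ^ 2) ^ (1/2:ℝ) := by
  obtain ⟨C1, hC1, H1⟩ := hls r1 h1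
  obtain ⟨C2, hC2, H2⟩ := hls r2 h2
  obtain ⟨C3, hC3, H3⟩ := hls r3 h3
  refine ⟨C3 * C2 * C1, by positivity, fun g hg => ?_⟩
  have hk1 := ker_measurable (1/2+1/r1)
  have hk2 := ker_measurable (1/2+1/r2)
  have hk3 := ker_measurable (1/2+1/r3)
  have hr10 : 0 < r1 := by linarith
  have hr20 : 0 < r2 := by linarith
  have hr30 : 0 < r3 := by linarith
  -- measurability
  set S1 : ℝ → ℝ → ℝ → ℝ≥0∞ := fun x1 y2 y3 => ∫⁻ y1, ker (1/2+1/r1) (x1 - y1) * g y1 y2 y3 with hS1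
  have mS1 : Measurable (fun z : ℝ × ℝ × ℝ => S1 z.1 z.2.1 z.2.2) := by
    refine Measurable.lintegral_prod_right' (f := fun w : (ℝ × ℝ × ℝ) × ℝ =>
      ker (1/2+1/r1) (w.1.1 - w.2) * g w.2 w.1.2.1 w.1.2.2) ?_
    have : Measurable fun w : (ℝ × ℝ × ℝ) × ℝ => g w.2 w.1.2.1 w.1.2.2 :=
      hg.comp (g := fun z : ℝ × ℝ × ℝ => g z.1 z.2.1 z.2.2)
        (f := fun w : (ℝ × ℝ × ℝ) × ℝ => (w.2, w.1.2.1, w.1.2.2)) (by fun_prop)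
    fun_prop
  set G1 : ℝ → ℝ → ℝ≥0∞ := fun y2 y3 => (∫⁻ y1, g y1 y2 y3 ^ 2) ^ (1/2:ℝ) with hG1
  have mG1 : Measurable (fun z : ℝ × ℝ => G1 z.1 z.2) := by
    refine Measurable.pow_const ?_ _
    refine Measurable.lintegral_prod_right' (f := fun w : (ℝ × ℝ) × ℝ => g w.2 w.1.1 w.1.2 ^ 2) ?_
    refine Measurable.pow_const ?_ _
    exact hg.comp (g := fun z : ℝ × ℝ × ℝ => g z.1 z.2.1 z.2.2)
        (f := fun w : (ℝ × ℝ) × ℝ => (w.2, w.1.1, w.1.2)) (by fun_prop)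
  set G2 : ℝ → ℝ≥0∞ := fun y3 => (∫⁻ y2, (ENNReal.ofReal C1 * G1 y2 y3) ^ 2) ^ (1/2:ℝ) with hG2
  have mG2 : Measurable G2 := by
    refine Measurable.pow_const ?_ _
    refine Measurable.lintegral_prod_right' (f := fun w : ℝ × ℝ =>
      (ENNReal.ofReal C1 * G1 w.2 w.1) ^ 2) ?_
    have : Measurable fun w : ℝ × ℝ => G1 w.2 w.1 := mG1.comp measurable_swap
    fun_prop
  have st1 : ∀ x2 x3, (∫⁻ x1, TT (1/2+1/r1) (1/2+1/r2) (1/2+1/r3) g x1 x2 x3 ^ r1) ^ (1/r1)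
      ≤ ∫⁻ y3, ker (1/2+1/r3) (x3 - y3) * ∫⁻ y2, ker (1/2+1/r2) (x2 - y2) *
          (ENNReal.ofReal C1 * G1 y2 y3) := by
    intro x2 x3
    refine (minkowski_w r1 (by linarith) (fun y3 => ker (1/2+1/r3) (x3 - y3)) (by fun_prop)
      (fun x1 y3 => ∫⁻ y2, ker (1/2+1/r2) (x2 - y2) * S1 x1 y2 y3) ?_).trans ?_
    · refine Measurable.lintegral_prod_right' (f := fun w : (ℝ × ℝ) × ℝ =>
        ker (1/2+1/r2) (x2 - w.2) * S1 w.1.1 w.2 w.1.2) ?_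
      have : Measurable fun w : (ℝ × ℝ) × ℝ => S1 w.1.1 w.2 w.1.2 :=
        mS1.comp (g := fun z : ℝ × ℝ × ℝ => S1 z.1 z.2.1 z.2.2)
          (f := fun w : (ℝ × ℝ) × ℝ => (w.1.1, w.2, w.1.2)) (by fun_prop)
      fun_prop
    · refine lintegral_mono fun y3 => mul_le_mul_right ?_ _
      refine (minkowski_w r1 (by linarith) (fun y2 => ker (1/2+1/r2) (x2 - y2)) (by fun_prop)
        (fun x1 y2 => S1 x1 y2 y3) ?_).trans ?_
      · exact mS1.comp (g := fun z : ℝ × ℝ × ℝ => S1 z.1 z.2.1 z.2.2)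
          (f := fun w : ℝ × ℝ => (w.1, w.2, y3)) (by fun_prop)
      · refine lintegral_mono fun y2 => mul_le_mul_right ?_ _
        refine H1 (fun y1 => g y1 y2 y3) ?_
        exact hg.comp (g := fun z : ℝ × ℝ × ℝ => g z.1 z.2.1 z.2.2)
          (f := fun w : ℝ => (w, y2, y3)) (by fun_prop)
  have st2 : ∀ x3, (∫⁻ x2, ((∫⁻ x1, TT (1/2+1/r1) (1/2+1/r2) (1/2+1/r3) g x1 x2 x3 ^ r1) ^ (1/r1)) ^ r2)
        ^ (1/r2) ≤ ∫⁻ y3, ker (1/2+1/r3) (x3 - y3) * (ENNReal.ofReal C2 * G2 y3) := by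
    intro x3
    calc _ ≤ (∫⁻ x2, (∫⁻ y3, ker (1/2+1/r3) (x3 - y3) * ∫⁻ y2, ker (1/2+1/r2) (x2 - y2) *
          (ENNReal.ofReal C1 * G1 y2 y3)) ^ r2) ^ (1/r2) := by
          refine ENNReal.rpow_le_rpow (lintegral_mono fun x2 => ?_) (by positivity)
          exact ENNReal.rpow_le_rpow (st1 x2 x3) hr20.le
      _ ≤ _ := by
          refine (minkowski_w r2 (by linarith) (fun y3 => ker (1/2+1/r3) (x3 - y3)) (by fun_prop)
            (fun x2 y3 => ∫⁻ y2, ker (1/2+1/r2) (x2 - y2) * (ENNReal.ofReal C1 * G1 y2 y3)) ?_).trans ?_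
          · refine Measurable.lintegral_prod_right' (f := fun w : (ℝ × ℝ) × ℝ =>
              ker (1/2+1/r2) (w.1.1 - w.2) * (ENNReal.ofReal C1 * G1 w.2 w.1.2)) ?_
            have : Measurable fun w : (ℝ × ℝ) × ℝ => G1 w.2 w.1.2 :=
              mG1.comp (g := fun z : ℝ × ℝ => G1 z.1 z.2)
                (f := fun w : (ℝ × ℝ) × ℝ => (w.2, w.1.2)) (by fun_prop)
            fun_prop
          · refine lintegral_mono fun y3 => mul_le_mul_right ?_ _
            refine H2 (fun y2 => ENNReal.ofReal C1 * G1 y2 y3) ?_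
            have : Measurable fun w : ℝ => G1 w y3 := mG1.comp (g := fun z : ℝ × ℝ => G1 z.1 z.2)
                (f := fun w : ℝ => (w, y3)) (by fun_prop)
            fun_prop
  have sq : ∀ a : ℝ≥0∞, (a ^ (1/2:ℝ)) ^ 2 = a := by
    intro a
    rw [← ENNReal.rpow_two, ← ENNReal.rpow_mul]; norm_num
  calc mix r1 r2 r3 (TT (1/2+1/r1) (1/2+1/r2) (1/2+1/r3) g)
      ≤ (∫⁻ x3, (∫⁻ y3, ker (1/2+1/r3) (x3 - y3) * (ENNReal.ofReal C2 * G2 y3)) ^ r3) ^ (1/r3) := by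
        refine ENNReal.rpow_le_rpow (lintegral_mono fun x3 => ?_) (by positivity)
        exact ENNReal.rpow_le_rpow (st2 x3) hr30.le
    _ ≤ ENNReal.ofReal C3 * (∫⁻ y3, (ENNReal.ofReal C2 * G2 y3) ^ 2) ^ (1/2:ℝ) :=
        H3 _ (by fun_prop)
    _ = _ := by
        simp only [mul_pow, hG2, hG1, sq]
        simp_rw [lintegral_const_mul' _ _ (ENNReal.pow_ne_top (n := 2) (ENNReal.ofReal_ne_top (r := C1)))]
        rw [lintegral_const_mul' _ _ (ENNReal.pow_ne_top ENNReal.ofReal_ne_top)]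
        rw [lintegral_const_mul' _ _ (ENNReal.pow_ne_top ENNReal.ofReal_ne_top)]
        rw [ENNReal.mul_rpow_of_nonneg _ _ (by norm_num), ENNReal.mul_rpow_of_nonneg _ _ (by norm_num)]
        have e : ∀ a : ℝ≥0∞, (a ^ 2) ^ (1/2:ℝ) = a := by
          intro a
          rw [← ENNReal.rpow_two, ← ENNReal.rpow_mul]; norm_num
        rw [e, e, ENNReal.ofReal_mul (by positivity), ENNReal.ofReal_mul (by positivity)]
        ring

end CubeAux

namespace CubeAux

lemma scaling (h : E3 → ℝ≥0∞) (hh : Measurable h) (x : E3) (s : ℝ) (hs : 0 < s) :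
    ∫⁻ y, h (x + s • (y - x)) = ENNReal.ofReal (s ^ 3)⁻¹ * ∫⁻ z, h z := by
  have e1 := lintegral_sub_right_eq_self (μ := (volume : Measure E3)) (fun y => h (x + s • y)) x
  rw [e1]
  have e2 := Measure.map_addHaar_smul (volume : Measure E3) hs.ne'
  have e3 : ∫⁻ y : E3, h (x + s • y) = ∫⁻ w, h (x + w) ∂(Measure.map (s • ·) (volume : Measure E3)) := by
    rw [lintegral_map (by fun_prop) (by fun_prop)]
  rw [e3, e2, lintegral_smul_measure, lintegral_add_left_eq_self (μ := (volume : Measure E3)) h x]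
  simp [abs_of_pos hs, smul_eq_mul]

lemma enorm_sub_le (f : E3 → E3) (hf : ContDiff ℝ 1 f) (x y : E3) :
    ‖f y - f x‖ₑ ≤ ∫⁻ s in Ioc (0:ℝ) 1, ‖fderiv ℝ f (x + s • (y - x))‖ₑ * ‖y - x‖ₑ := by
  have hc : Continuous (fderiv ℝ f) := hf.continuous_fderiv (by norm_num)
  have hd : ∀ s ∈ uIcc (0:ℝ) 1, HasDerivAt (fun s : ℝ => f (x + s • (y - x)))
      (fderiv ℝ f (x + s • (y - x)) (y - x)) s := by
    intro s _
    have h1 : HasFDerivAt f (fderiv ℝ f (x + s • (y - x))) (x + s • (y - x)) :=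
      (hf.differentiable (by norm_num) _).hasFDerivAt
    have h2 : HasDerivAt (fun s : ℝ => x + s • (y - x)) (y - x) s := by
      have := ((hasDerivAt_id s).smul_const (y - x)).const_add x
      simpa using this
    exact h1.comp_hasDerivAt s h2
  have hcont : Continuous fun s : ℝ => fderiv ℝ f (x + s • (y - x)) (y - x) := by fun_prop
  have := intervalIntegral.integral_eq_sub_of_hasDerivAt hd (hcont.intervalIntegrable _ _)
  simp only [one_smul, zero_smul, add_zero, add_sub_cancel] at this
  rw [← this, intervalIntegral.integral_of_le zero_le_one]
  refine (enorm_integral_le_lintegral_enorm _).trans (lintegral_mono fun s => ?_)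
  exact ContinuousLinearMap.le_opENorm _ _

lemma rep (Ω : Set E3) (hΩ : Convex ℝ Ω) (hm : MeasurableSet Ω) (d : ℝ) (hd : 0 < d) (x : E3)
    (hx : x ∈ Ω) (hdx : ∀ y ∈ Ω, ‖y - x‖ ≤ d) (f : E3 → E3) (hf : ContDiff ℝ 1 f) :
    ∫⁻ y in Ω, ‖f y - f x‖ₑ ≤ ENNReal.ofReal (d ^ 3 / 3) *
      ∫⁻ z in Ω, ‖fderiv ℝ f z‖ₑ * ENNReal.ofReal ‖z - x‖ ^ (-2:ℝ) := by
  have hc : Continuous (fderiv ℝ f) := hf.continuous_fderiv (by norm_num)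
  have hms : MeasurableSet {p : ℝ × E3 | ‖p.2 - x‖ ≤ p.1 * d} :=
    measurableSet_le (by fun_prop) (by fun_prop)
  set H : ℝ → E3 → ℝ≥0∞ := fun s z => Ω.indicator (fun z => ‖fderiv ℝ f z‖ₑ * ‖z - x‖ₑ) z *
    {p : ℝ × E3 | ‖p.2 - x‖ ≤ p.1 * d}.indicator 1 (s, z) with hH
  have mH0 : Measurable (Ω.indicator (fun z => ‖fderiv ℝ f z‖ₑ * ‖z - x‖ₑ)) := by
    apply Measurable.indicator _ hm
    have := hc.measurable
    fun_prop
  have mH : Measurable fun p : ℝ × E3 => H p.1 p.2 := by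
    refine Measurable.mul (mH0.comp measurable_snd) ?_
    exact measurable_one.indicator hms
  have mH' : ∀ s, Measurable (H s) := fun s => mH.comp (by fun_prop : Measurable fun z => (s, z))
  calc ∫⁻ y in Ω, ‖f y - f x‖ₑ
      ≤ ∫⁻ y in Ω, ∫⁻ s in Ioc (0:ℝ) 1, ‖fderiv ℝ f (x + s • (y - x))‖ₑ * ‖y - x‖ₑ :=
        lintegral_mono fun y => enorm_sub_le f hf x y
    _ = ∫⁻ s in Ioc (0:ℝ) 1, ∫⁻ y in Ω, ‖fderiv ℝ f (x + s • (y - x))‖ₑ * ‖y - x‖ₑ := by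
        rw [lintegral_lintegral_swap]
        refine Measurable.aemeasurable ?_
        have : Measurable fun p : E3 × ℝ => fderiv ℝ f (x + p.2 • (p.1 - x)) :=
          Continuous.measurable (by fun_prop)
        simp only [Function.uncurry_def]
        fun_prop
    _ ≤ ∫⁻ s in Ioc (0:ℝ) 1, ENNReal.ofReal (s ^ (-4:ℝ)) * ∫⁻ z, H s z := by
        refine setLIntegral_mono' measurableSet_Ioc fun s hs => ?_
        have hs0 : 0 < s := hs.1
        have e4 : ENNReal.ofReal (s ^ (-4:ℝ)) = ENNReal.ofReal s⁻¹ * ENNReal.ofReal (s ^ 3)⁻¹ := by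
          rw [← ENNReal.ofReal_mul (by positivity), Real.rpow_neg hs0.le]
          congr 1
          have : s ^ (4:ℝ) = s ^ 4 := by exact_mod_cast Real.rpow_natCast s 4
          rw [this]; field_simp
        rw [e4, mul_assoc, ← scaling (H s) (mH' s) x s hs0, ← lintegral_const_mul' _ _ (by simp),
          ← lintegral_indicator hm]
        refine lintegral_mono fun y => ?_
        by_cases hy : y ∈ Ω
        · have hz : x + s • (y - x) ∈ Ω := hΩ.add_smul_sub_mem hx hy ⟨hs.1.le, hs.2⟩
          have hz2 : ‖x + s • (y - x) - x‖ ≤ s * d := by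
            rw [add_sub_cancel_left, norm_smul, Real.norm_of_nonneg hs0.le]
            gcongr; exact hdx y hy
          have hmem : ((s, x + s • (y - x)) : ℝ × E3) ∈ {p : ℝ × E3 | ‖p.2 - x‖ ≤ p.1 * d} := hz2
          simp only [hH, indicator_of_mem hy, indicator_of_mem hz, indicator_of_mem hmem,
            Pi.one_apply, mul_one]
          rw [add_sub_cancel_left, enorm_smul, mul_left_comm]
          refine mul_le_mul_right (le_of_eq ?_) _
          rw [← mul_assoc, Real.enorm_of_nonneg hs0.le, ← ENNReal.ofReal_mul (by positivity),
            inv_mul_cancel₀ hs0.ne']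
          simp
        · simp [hy]
    _ = ∫⁻ s in Ioc (0:ℝ) 1, ∫⁻ z, ENNReal.ofReal (s ^ (-4:ℝ)) * H s z := by
        refine lintegral_congr fun s => ?_
        rw [lintegral_const_mul' _ _ (by simp)]
    _ = ∫⁻ z, ∫⁻ s in Ioc (0:ℝ) 1, ENNReal.ofReal (s ^ (-4:ℝ)) * H s z := by
        rw [lintegral_lintegral_swap]
        refine Measurable.aemeasurable ?_
        refine Measurable.mul (by fun_prop) mH
    _ ≤ ∫⁻ z, Ω.indicator (fun z => ENNReal.ofReal (d ^ 3 / 3) *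
          (‖fderiv ℝ f z‖ₑ * ENNReal.ofReal ‖z - x‖ ^ (-2:ℝ))) z := by
        refine lintegral_mono_ae ?_
        have : ∀ᵐ z : E3, z ≠ x := by simp [ae_iff, measure_singleton]
        filter_upwards [this] with z hzx
        by_cases hz : z ∈ Ω
        · have hn : 0 < ‖z - x‖ := norm_pos_iff.2 (sub_ne_zero.2 hzx)
          simp only [hH, indicator_of_mem hz]
          calc _ ≤ ∫⁻ s in Ici (‖z - x‖ / d), ENNReal.ofReal (s ^ (-4:ℝ)) *
                (‖fderiv ℝ f z‖ₑ * ‖z - x‖ₑ) := by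
                rw [← lintegral_indicator measurableSet_Ioc, ← lintegral_indicator measurableSet_Ici]
                refine lintegral_mono fun s => ?_
                by_cases h1 : s ∈ Ioc (0:ℝ) 1
                · by_cases h2 : ‖z - x‖ ≤ s * d
                  · have h3 : s ∈ Ici (‖z - x‖ / d) := by
                      rw [mem_Ici, div_le_iff₀ hd]; exact h2
                    have h4 : ((s, z) : ℝ × E3) ∈ {p : ℝ × E3 | ‖p.2 - x‖ ≤ p.1 * d} := h2
                    simp only [indicator_of_mem h1, indicator_of_mem h3, indicator_of_mem h4,
                      Pi.one_apply, mul_one]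
                    exact le_refl _
                  · have : ((s, z) : ℝ × E3) ∉ {p : ℝ × E3 | ‖p.2 - x‖ ≤ p.1 * d} := h2
                    simp only [indicator_of_mem h1, indicator_of_notMem this]
                    simp
                · simp [h1]
            _ = _ := by
                rw [lintegral_mul_const _ (by fun_prop), setLIntegral_congr Ioi_ae_eq_Ici.symm,
                  lint_Ioi _ _ (by positivity) (by norm_num), mul_left_comm, mul_left_comm (ENNReal.ofReal (d ^ 3 / 3))]
                congr 1
                rw [← ofReal_norm, ← ENNReal.ofReal_mul, ENNReal.ofReal_rpow_of_pos hn,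
                  ← ENNReal.ofReal_mul (by positivity)]
                · congr 1
                  have a1 : (-4:ℝ) + 1 = -((3:ℕ):ℝ) := by norm_num
                  have a2 : (-2:ℝ) = -((2:ℕ):ℝ) := by norm_num
                  rw [a1, a2, Real.rpow_neg (by positivity), Real.rpow_neg (by positivity),
                    Real.rpow_natCast, Real.rpow_natCast]
                  field_simp
                  push_cast; norm_num
                · have : 0 < (‖z - x‖ / d) ^ ((-4:ℝ) + 1) := by positivity
                  have e : -(‖z - x‖ / d) ^ ((-4:ℝ) + 1) / (-4 + 1) = (‖z - x‖ / d) ^ ((-4:ℝ) + 1) / 3 := by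
                    ring
                  rw [e]; positivity
        · simp [hH, hz]
    _ = _ := by
        rw [lintegral_indicator hm, lintegral_const_mul' _ _ (by simp)]

end CubeAux

namespace CubeAux

lemma pt3_measurable : Measurable (fun z : ℝ × ℝ × ℝ => pt3 z.1 z.2.1 z.2.2) := by
  have h : Measurable (fun z : ℝ × ℝ × ℝ => (![z.1, z.2.1, z.2.2] : Fin 3 → ℝ)) := by
    refine measurable_pi_lambda _ fun i => ?_
    fin_cases i <;> simp <;> fun_prop
  exact (PiLp.continuous_toLp 2 (fun _ : Fin 3 => ℝ)).measurable.comp h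

lemma lint_pt3 (f : E3 → ℝ≥0∞) (hf : Measurable f) :
    ∫⁻ x, f x = ∫⁻ x3, ∫⁻ x2, ∫⁻ x1, f (pt3 x1 x2 x3) := by
  have h1 := (PiLp.volume_preserving_toLp (Fin 3)).lintegral_comp hf
  rw [← h1]
  have h2 := (volume_preserving_piFinSuccAbove (fun _ : Fin 3 => ℝ) 2).symm
  have h3 := (volume_preserving_finTwoArrow ℝ).symm
  have hm : Measurable fun a : Fin 3 → ℝ => f (WithLp.toLp 2 a) :=
    hf.comp (PiLp.continuous_toLp 2 _).measurable
  rw [← h2.lintegral_comp hm]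
  rw [Measure.volume_eq_prod, lintegral_prod _ (by
    exact (hm.comp (MeasurableEquiv.measurable _)).aemeasurable)]
  refine lintegral_congr fun x3 => ?_
  rw [← h3.lintegral_comp (by
    exact hm.comp ((MeasurableEquiv.measurable _).comp (by fun_prop)))]
  rw [Measure.volume_eq_prod, lintegral_prod_symm _ (by
    exact (hm.comp ((MeasurableEquiv.measurable _).comp (by fun_prop))).aemeasurable)]
  refine lintegral_congr fun x2 => lintegral_congr fun x1 => ?_
  congr 1
  simp only [pt3]
  ext i
  fin_cases i <;> simp [MeasurableEquiv.piFinSuccAbove, MeasurableEquiv.finTwoArrow, Fin.insertNthEquiv] <;> rfl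

lemma ker_prod (b1 b2 b3 : ℝ) (h1 : 0 ≤ b1) (h2 : 0 ≤ b2) (h3 : 0 ≤ b3) (x y : E3) :
    ENNReal.ofReal ‖y - x‖ ^ (-(b1 + b2 + b3)) ≤
      ker b3 (x 2 - y 2) * (ker b2 (x 1 - y 1) * ker b1 (x 0 - y 0)) := by
  have hb : ∀ i : Fin 3, |x i - y i| ≤ ‖y - x‖ := by
    intro i
    have := PiLp.norm_apply_le (y - x) i
    rw [abs_sub_comm]; simpa using this
  have hk : ∀ (i : Fin 3) (b : ℝ), 0 ≤ b → ENNReal.ofReal ‖y - x‖ ^ (-b) ≤ ker b (x i - y i) := by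
    intro i b hb0
    unfold ker
    rw [ENNReal.rpow_neg, ENNReal.rpow_neg]
    exact ENNReal.inv_le_inv.2 (ENNReal.rpow_le_rpow (ENNReal.ofReal_le_ofReal (hb i)) hb0)
  refine le_trans (le_of_eq ?_) (mul_le_mul' (hk 2 b3 h3) (mul_le_mul' (hk 1 b2 h2) (hk 0 b1 h1)))
  simp only [ENNReal.rpow_neg]
  rw [ENNReal.rpow_add_of_nonneg _ _ (by positivity) h3, ENNReal.rpow_add_of_nonneg _ _ h1 h2,
    ENNReal.mul_inv, ENNReal.mul_inv]
  · ring
  all_goals first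
    | exact Or.inr (by finiteness)
    | exact Or.inl (by finiteness)

lemma le_TT (b1 b2 b3 : ℝ) (h1 : 0 ≤ b1) (h2 : 0 ≤ b2) (h3 : 0 ≤ b3) (g : E3 → ℝ≥0∞)
    (hg : Measurable g) (x1 x2 x3 : ℝ) :
    ∫⁻ y, ENNReal.ofReal ‖y - pt3 x1 x2 x3‖ ^ (-(b1 + b2 + b3)) * g y ≤
      TT b1 b2 b3 (fun y1 y2 y3 => g (pt3 y1 y2 y3)) x1 x2 x3 := by
  have hgm : Measurable (fun z : ℝ × ℝ × ℝ => g (pt3 z.1 z.2.1 z.2.2)) := hg.comp pt3_measurable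
  have hk1 := ker_measurable b1
  have hk2 := ker_measurable b2
  have hk3 := ker_measurable b3
  rw [lint_pt3 _ (by fun_prop)]
  unfold TT
  refine lintegral_mono fun y3 => ?_
  rw [← lintegral_const_mul]
  swap
  · refine Measurable.mul (by fun_prop) ?_
    refine Measurable.lintegral_prod_right' (f := fun w : ℝ × ℝ => ker b1 (x1 - w.2) *
      g (pt3 w.2 w.1 y3)) ?_
    have : Measurable fun w : ℝ × ℝ => g (pt3 w.2 w.1 y3) :=
      hgm.comp (by fun_prop : Measurable fun w : ℝ × ℝ => (w.2, w.1, y3))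
    exact Measurable.mul (by fun_prop) this
  refine lintegral_mono fun y2 => ?_
  have m1 : Measurable fun y1 : ℝ => g (pt3 y1 y2 y3) :=
      hgm.comp (by fun_prop : Measurable fun w : ℝ => (w, y2, y3))
  beta_reduce
  have m2 : Measurable fun y1 : ℝ => ker b1 (x1 - y1) * g (pt3 y1 y2 y3) :=
    (hk1.comp (by fun_prop)).mul m1
  rw [← lintegral_const_mul _ m2, ← lintegral_const_mul _ (m2.const_mul _)]
  refine lintegral_mono fun y1 => ?_
  have := ker_prod b1 b2 b3 h1 h2 h3 (pt3 x1 x2 x3) (pt3 y1 y2 y3)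
  refine (mul_le_mul_left this _).trans (le_of_eq ?_)
  simp only [pt3, mul_assoc]
  rfl

lemma mix_mono (r1 r2 r3 : ℝ) (h1 : 0 ≤ r1) (h2 : 0 ≤ r2) (h3 : 0 ≤ r3)
    (F G : ℝ → ℝ → ℝ → ℝ≥0∞) (h : ∀ x1 x2 x3, F x1 x2 x3 ≤ G x1 x2 x3) :
    mix r1 r2 r3 F ≤ mix r1 r2 r3 G := by
  unfold mix
  gcongr
  exact h _ _ _

lemma mix_sq (q1 q2 q3 : ℝ) (F : ℝ → ℝ → ℝ → ℝ≥0∞) :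
    mix q1 q2 q3 (fun x1 x2 x3 => F x1 x2 x3 ^ 2) = mix (2 * q1) (2 * q2) (2 * q3) F ^ 2 := by
  have e1 : ∀ (a : ℝ≥0∞) (q : ℝ), (a ^ 2) ^ q = a ^ (2 * q) := by
    intro a q; rw [← ENNReal.rpow_two, ← ENNReal.rpow_mul]
  have e2 : ∀ (a : ℝ≥0∞) (q : ℝ), a ^ (1 / q) = (a ^ (1 / (2 * q))) ^ 2 := by
    intro a q; rw [← ENNReal.rpow_two, ← ENNReal.rpow_mul]; congr 1; field_simp
  unfold mix
  simp only [e1]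
  simp only [e2 _ q1, e1]
  simp only [e2 _ q2, e1]
  rw [e2 _ q3]

lemma mix_holder (q1 q2 q3 p1 p2 p3 : ℝ) (h1 : q1.HolderConjugate p1) (h2 : q2.HolderConjugate p2)
    (h3 : q3.HolderConjugate p3) (F G : ℝ → ℝ → ℝ → ℝ≥0∞)
    (hF : Measurable (fun z : ℝ × ℝ × ℝ => F z.1 z.2.1 z.2.2))
    (hG : Measurable (fun z : ℝ × ℝ × ℝ => G z.1 z.2.1 z.2.2)) :
    ∫⁻ x3, ∫⁻ x2, ∫⁻ x1, F x1 x2 x3 * G x1 x2 x3 ≤ mix q1 q2 q3 F * mix p1 p2 p3 G := by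
  have m1 : ∀ (H : ℝ → ℝ → ℝ → ℝ≥0∞) (_ : Measurable (fun z : ℝ × ℝ × ℝ => H z.1 z.2.1 z.2.2)),
      ∀ x2 x3, Measurable fun x1 => H x1 x2 x3 := fun H hH x2 x3 =>
    hH.comp (by fun_prop : Measurable fun w : ℝ => (w, x2, x3))
  have m2 : ∀ (H : ℝ → ℝ → ℝ → ℝ≥0∞) (_ : Measurable (fun z : ℝ × ℝ × ℝ => H z.1 z.2.1 z.2.2))
      (q : ℝ), Measurable fun w : ℝ × ℝ => (∫⁻ x1, H x1 w.1 w.2 ^ q) ^ (1/q) := by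
    intro H hH q
    refine Measurable.pow_const ?_ _
    refine Measurable.lintegral_prod_right' (f := fun w : (ℝ × ℝ) × ℝ => H w.2 w.1.1 w.1.2 ^ q) ?_
    refine Measurable.pow_const ?_ _
    exact hH.comp (by fun_prop : Measurable fun w : (ℝ × ℝ) × ℝ => (w.2, w.1.1, w.1.2))
  have m3 : ∀ (H : ℝ → ℝ → ℝ → ℝ≥0∞) (_ : Measurable (fun z : ℝ × ℝ × ℝ => H z.1 z.2.1 z.2.2))
      (q r : ℝ), Measurable fun x3 : ℝ => (∫⁻ x2, ((∫⁻ x1, H x1 x2 x3 ^ q) ^ (1/q)) ^ r) ^ (1/r) := by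
    intro H hH q r
    refine Measurable.pow_const ?_ _
    refine Measurable.lintegral_prod_right' (f := fun w : ℝ × ℝ =>
      ((∫⁻ x1, H x1 w.2 w.1 ^ q) ^ (1/q)) ^ r) ?_
    refine Measurable.pow_const ?_ _
    exact (m2 H hH q).comp measurable_swap
  calc _ ≤ ∫⁻ x3, ∫⁻ x2, (∫⁻ x1, F x1 x2 x3 ^ q1) ^ (1/q1) * (∫⁻ x1, G x1 x2 x3 ^ p1) ^ (1/p1) := by
        refine lintegral_mono fun x3 => lintegral_mono fun x2 => ?_
        exact ENNReal.lintegral_mul_le_Lp_mul_Lq volume h1 (m1 F hF x2 x3).aemeasurable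
          (m1 G hG x2 x3).aemeasurable
    _ ≤ ∫⁻ x3, (∫⁻ x2, ((∫⁻ x1, F x1 x2 x3 ^ q1) ^ (1/q1)) ^ q2) ^ (1/q2) *
          (∫⁻ x2, ((∫⁻ x1, G x1 x2 x3 ^ p1) ^ (1/p1)) ^ p2) ^ (1/p2) := by
        refine lintegral_mono fun x3 => ?_
        refine ENNReal.lintegral_mul_le_Lp_mul_Lq volume h2 ?_ ?_
        · exact ((m2 F hF q1).comp (by fun_prop : Measurable fun w : ℝ => (w, x3))).aemeasurable
        · exact ((m2 G hG p1).comp (by fun_prop : Measurable fun w : ℝ => (w, x3))).aemeasurable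
    _ ≤ _ := ENNReal.lintegral_mul_le_Lp_mul_Lq volume h3 (m3 F hF q1 q2).aemeasurable
          (m3 G hG p1 p2).aemeasurable

lemma aniso_eq (q1 q2 q3 : ℝ) (Ω : Set E3) (f : E3 → E3) :
    anisoNorm q1 q2 q3 Ω (fun x => ‖f x‖) =
      mix q1 q2 q3 (fun x1 x2 x3 => Ω.indicator (fun x => ‖f x‖ₑ) (pt3 x1 x2 x3)) := by
  have e0 : ∀ x, ENNReal.ofReal |Ω.indicator (fun x => ‖f x‖) x| = Ω.indicator (fun x => ‖f x‖ₑ) x := by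
    intro x
    by_cases h : x ∈ Ω <;> simp [h]
  have e1 : ∀ (a : ℝ≥0∞) (q r : ℝ), a ^ (r / q) = (a ^ (1/q)) ^ r := by
    intro a q r; rw [← ENNReal.rpow_mul]; congr 1; ring
  unfold anisoNorm mix
  simp only [e0, e1 _ q1 q2, e1 _ q2 q3]

end CubeAux

namespace CubeAux

lemma slice_core (q1 q2 q3 : ℝ) (hq1 : 1 < q1) (hq2 : 1 < q2) (hq3 : 1 < q3) :
    ∃ C : ℝ, 0 < C ∧ ∀ (B : Set E3) (_ : MeasurableSet B) (w : E3 → E3) (_ : Measurable w)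
      (g : E3 → ℝ≥0∞) (_ : Measurable g)
      (_ : ∀ x ∈ B, ‖w x‖ₑ ≤ ∫⁻ y, ENNReal.ofReal ‖y - x‖ ^ (-(3 - (1/q1+1/q2+1/q3)/2)) * g y),
      ∫⁻ x in B, ‖w x‖ₑ ^ 3 ≤ ENNReal.ofReal C * anisoNorm q1 q2 q3 B (fun x => ‖w x‖)
        * ∫⁻ y, g y ^ 2 := by
  have c1 := Real.HolderConjugate.conjExponent hq1
  have c2 := Real.HolderConjugate.conjExponent hq2
  have c3 := Real.HolderConjugate.conjExponent hq3
  set p1 := q1.conjExponent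
  set p2 := q2.conjExponent
  set p3 := q3.conjExponent
  have l1 := c1.symm.lt
  have l2 := c2.symm.lt
  have l3 := c3.symm.lt
  obtain ⟨C, hC, H⟩ := TT_bound (2*p1) (2*p2) (2*p3) (by linarith) (by linarith) (by linarith)
  refine ⟨C ^ 2, by positivity, fun B hB w hw g hg h => ?_⟩
  rw [aniso_eq]
  set W : ℝ → ℝ → ℝ → ℝ≥0∞ := fun x1 x2 x3 => B.indicator (fun x => ‖w x‖ₑ) (pt3 x1 x2 x3) with hW
  have hWm : Measurable (fun z : ℝ × ℝ × ℝ => W z.1 z.2.1 z.2.2) :=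
    ((hw.enorm).indicator hB).comp pt3_measurable
  have e0 : ∫⁻ x in B, ‖w x‖ₑ ^ 3 = ∫⁻ x3, ∫⁻ x2, ∫⁻ x1, W x1 x2 x3 * W x1 x2 x3 ^ 2 := by
    rw [← lintegral_indicator hB, lint_pt3 _ (by
      apply Measurable.indicator _ hB
      fun_prop)]
    refine lintegral_congr fun x3 => lintegral_congr fun x2 => lintegral_congr fun x1 => ?_
    by_cases hx : pt3 x1 x2 x3 ∈ B
    · simp only [hW, indicator_of_mem hx]; ring
    · simp [hW, indicator_of_notMem hx]
  rw [e0]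
  refine (mix_holder q1 q2 q3 p1 p2 p3 c1 c2 c3 W (fun x1 x2 x3 => W x1 x2 x3 ^ 2) hWm
    (hWm.pow_const 2)).trans ?_
  rw [mix_sq]
  have hb : ∀ q p : ℝ, q.HolderConjugate p → 1/2 + 1/(2*p) = 1 - 1/q/2 := by
    intro q p h
    have := h.inv_add_inv_eq_one
    have hp : p⁻¹ = 1 - q⁻¹ := by linarith
    rw [one_div (2*p), mul_inv, hp]; ring
  have b1 := hb q1 p1 c1
  have b2 := hb q2 p2 c2
  have b3 := hb q3 p3 c3
  have hle : mix (2*p1) (2*p2) (2*p3) W ≤ ENNReal.ofReal C * (∫⁻ y, g y ^ 2) ^ (1/2:ℝ) := by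
    rw [lint_pt3 _ (by fun_prop)]
    refine le_trans ?_ (H (fun y1 y2 y3 => g (pt3 y1 y2 y3)) (hg.comp pt3_measurable))
    refine mix_mono _ _ _ (by linarith) (by linarith) (by linarith) _ _ fun x1 x2 x3 => ?_
    by_cases hx : pt3 x1 x2 x3 ∈ B
    · simp only [hW, indicator_of_mem hx]
      refine (h _ hx).trans ?_
      have := le_TT (1/2+1/(2*p1)) (1/2+1/(2*p2)) (1/2+1/(2*p3)) (by positivity) (by positivity)
        (by positivity) g hg x1 x2 x3
      refine le_trans (le_of_eq ?_) this
      rw [b1, b2, b3]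
      refine lintegral_congr fun y => ?_
      congr 3
      ring
    · simp [hW, indicator_of_notMem hx]
  calc mix q1 q2 q3 W * mix (2*p1) (2*p2) (2*p3) W ^ 2
      ≤ mix q1 q2 q3 W * (ENNReal.ofReal C * (∫⁻ y, g y ^ 2) ^ (1/2:ℝ)) ^ 2 :=
        mul_le_mul' le_rfl (pow_le_pow_left' hle 2)
    _ = _ := by
        rw [mul_pow, ← ENNReal.rpow_two (_ ^ (1/2:ℝ)), ← ENNReal.rpow_mul, ENNReal.ofReal_pow hC.le]
        norm_num
        ring

lemma ker_cmp (a d α β : ℝ) (ha : 0 ≤ a) (hd : 0 < d) (had : a ≤ d) (hab : α ≤ β) (hβ : 0 < β) :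
    ENNReal.ofReal a ^ (-α) ≤ ENNReal.ofReal (d ^ (β - α)) * ENNReal.ofReal a ^ (-β) := by
  rcases ha.eq_or_lt with rfl | ha
  · rw [ENNReal.ofReal_zero, ENNReal.zero_rpow_of_neg (by linarith : -β < 0), ENNReal.mul_top]
    · exact le_top
    · simp; positivity
  · rw [ENNReal.ofReal_rpow_of_pos ha, ENNReal.ofReal_rpow_of_pos ha,
      ← ENNReal.ofReal_mul (by positivity)]
    apply ENNReal.ofReal_le_ofReal
    have : a ^ (-α) = a ^ (β - α) * a ^ (-β) := by
      rw [← Real.rpow_add ha]; congr 1; ring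
    rw [this]
    gcongr

lemma caseB_pt (θ : ℝ) (h0 : 0 < θ) (h1 : θ ≤ 1) (Ω : Set E3) (hΩ : MeasurableSet Ω) (R : ℝ)
    (hR : 0 < R) (x : E3) (hx : ball x R ⊆ Ω) (f : E3 → E3) (hf : ContDiff ℝ 1 f) (c : E3) :
    volume (ball (0:E3) 1) * ‖f x - c‖ₑ ≤ ∫⁻ y, ENNReal.ofReal ‖y - x‖ ^ (-(3 - θ)) *
      Ω.indicator (fun y => ENNReal.ofReal (R ^ (1 - θ)) * ‖fderiv ℝ f y‖ₑ +
        ENNReal.ofReal (R ^ (-θ)) * ‖f y - c‖ₑ) y := by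
  have hfm : Measurable f := hf.continuous.measurable
  have hdm : Measurable (fderiv ℝ f) := (hf.continuous_fderiv (by norm_num)).measurable
  have hvol : volume (ball x R) = ENNReal.ofReal (R ^ 3) * volume (ball (0:E3) 1) := by
    rw [Measure.addHaar_ball _ _ hR.le]; simp
  have hball : MeasurableSet (ball x R) := measurableSet_ball
  have r := rep (ball x R) (convex_ball x R) hball R hR x (mem_ball_self hR)
    (fun y hy => (mem_ball_iff_norm.1 hy).le) f hf
  have s1 : ENNReal.ofReal (R ^ 3) * (volume (ball (0:E3) 1) * ‖f x - c‖ₑ) ≤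
      ENNReal.ofReal (R ^ 3) * ∫⁻ y in ball x R, ENNReal.ofReal ‖y - x‖ ^ (-(3 - θ)) *
       (ENNReal.ofReal (R ^ (1 - θ)) * ‖fderiv ℝ f y‖ₑ + ENNReal.ofReal (R ^ (-θ)) * ‖f y - c‖ₑ) := by
    calc _ = ∫⁻ y in ball x R, ‖f x - c‖ₑ := by
          rw [setLIntegral_const, hvol]; ring
      _ ≤ ∫⁻ y in ball x R, (‖f y - f x‖ₑ + ‖f y - c‖ₑ) := by
          refine lintegral_mono fun y => ?_
          have : f x - c = (f y - c) - (f y - f x) := by abel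
          rw [this, add_comm]
          exact _root_.enorm_sub_le
      _ = (∫⁻ y in ball x R, ‖f y - f x‖ₑ) + ∫⁻ y in ball x R, ‖f y - c‖ₑ :=
          lintegral_add_left (by fun_prop) _
      _ ≤ ENNReal.ofReal (R ^ 3) * (∫⁻ z in ball x R, ‖fderiv ℝ f z‖ₑ *
            ENNReal.ofReal ‖z - x‖ ^ (-2:ℝ)) + ∫⁻ y in ball x R, ‖f y - c‖ₑ := by
          refine add_le_add (r.trans (mul_le_mul' (ENNReal.ofReal_le_ofReal ?_) le_rfl)) le_rfl
          have : 0 < R ^ 3 := by positivity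
          linarith
      _ ≤ ENNReal.ofReal (R ^ 3) * (∫⁻ y in ball x R, ENNReal.ofReal ‖y - x‖ ^ (-(3 - θ)) *
            (ENNReal.ofReal (R ^ (1 - θ)) * ‖fderiv ℝ f y‖ₑ)) +
            ENNReal.ofReal (R ^ 3) * ∫⁻ y in ball x R, ENNReal.ofReal ‖y - x‖ ^ (-(3 - θ)) *
            (ENNReal.ofReal (R ^ (-θ)) * ‖f y - c‖ₑ) := by
          refine add_le_add (mul_le_mul' le_rfl ?_) ?_
          · refine setLIntegral_mono' hball fun y hy => ?_
            have := ker_cmp ‖y - x‖ R 2 (3 - θ) (norm_nonneg _) hR (mem_ball_iff_norm.1 hy).le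
              (by linarith) (by linarith)
            refine (mul_le_mul' le_rfl this).trans (le_of_eq ?_)
            rw [show 3 - θ - 2 = 1 - θ by ring]; ring
          · rw [← lintegral_const_mul _ (by fun_prop)]
            refine setLIntegral_mono' hball fun y hy => ?_
            have := ker_cmp ‖y - x‖ R 0 (3 - θ) (norm_nonneg _) hR (mem_ball_iff_norm.1 hy).le
              (by linarith) (by linarith)
            rw [neg_zero, ENNReal.rpow_zero] at this
            calc ‖f y - c‖ₑ = 1 * ‖f y - c‖ₑ := (one_mul _).symm
              _ ≤ _ := mul_le_mul' this le_rfl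
              _ = _ := by
                have : R ^ (3 - θ - 0) = R ^ 3 * R ^ (-θ) := by
                  rw [← Real.rpow_natCast, ← Real.rpow_add hR]; congr 1; push_cast; ring
                rw [this, ENNReal.ofReal_mul (by positivity)]; ring
      _ = _ := by
          rw [← mul_add, ← lintegral_add_left (by fun_prop)]
          simp only [mul_add]
  have hR3 : 0 < R ^ 3 := by positivity
  refine ((ENNReal.mul_le_mul_iff_right (by simpa using hR3) ENNReal.ofReal_ne_top).1 s1).trans ?_
  rw [← lintegral_indicator hball]
  refine lintegral_mono fun y => ?_
  by_cases hy : y ∈ ball x R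
  · simp [indicator_of_mem hy, indicator_of_mem (hx hy)]
  · simp [indicator_of_notMem hy]

lemma caseA_pt (θ : ℝ) (h1 : θ ≤ 1) (h0 : 0 < θ) (ϱ : ℝ) (hϱ : 0 < ϱ) (x : E3)
    (hx : x ∈ ball (0:E3) ϱ) (f : E3 → E3) (hf : ContDiff ℝ 1 f) :
    volume (ball (0:E3) 1) * ‖f x - ⨍ y in ball (0:E3) (Real.sqrt 2 * ϱ), f y‖ₑ ≤
      ∫⁻ y, ENNReal.ofReal ‖y - x‖ ^ (-(3 - θ)) *
      (ball (0:E3) (Real.sqrt 2 * ϱ)).indicator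
        (fun y => ENNReal.ofReal (8 * ϱ ^ (1 - θ)) * ‖fderiv ℝ f y‖ₑ) y := by
  have hfm : Measurable f := hf.continuous.measurable
  have hdm : Measurable (fderiv ℝ f) := (hf.continuous_fderiv (by norm_num)).measurable
  have hs1 : 1 ≤ Real.sqrt 2 := by rw [Real.one_le_sqrt]; norm_num
  have hs2 : Real.sqrt 2 ≤ 3/2 := by rw [Real.sqrt_le_left (by norm_num)]; norm_num
  set r := Real.sqrt 2 * ϱ with hr
  have hrp : 0 < r := by positivity
  have hϱr : ϱ ≤ r := by nlinarith
  have hr2 : 2 * r ≤ 3 * ϱ := by nlinarith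
  set Ω := ball (0:E3) r with hΩ
  have hΩm : MeasurableSet Ω := measurableSet_ball
  have hvol : volume Ω = ENNReal.ofReal (r ^ 3) * volume (ball (0:E3) 1) := by
    rw [hΩ, Measure.addHaar_ball _ _ hrp.le]; simp
  have hd : ∀ y ∈ Ω, ‖y - x‖ ≤ 2 * r := by
    intro y hy
    have a := mem_ball_zero_iff.1 hy
    have b := mem_ball_zero_iff.1 hx
    have := norm_sub_le y x
    linarith
  have rp := rep Ω (convex_ball _ _) hΩm (2 * r) (by positivity) x (ball_subset_ball hϱr hx) hd f hf
  have hv0 : volume Ω ≠ 0 := (measure_ball_pos _ _ hrp).ne'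
  have hvt : volume Ω ≠ ∞ := measure_ball_lt_top.ne
  have hfint : IntegrableOn f Ω volume :=
    (hf.continuous.continuousOn.integrableOn_compact (isCompact_closedBall (0:E3) r)).mono_set
      ball_subset_closedBall
  have avg : volume Ω * ‖f x - ⨍ y in Ω, f y‖ₑ ≤ ∫⁻ y in Ω, ‖f y - f x‖ₑ := by
    have e : f x - ⨍ y in Ω, f y = (volume.real Ω)⁻¹ • ∫ y in Ω, (f x - f y) := by
      have hi0 : Integrable (fun _ : E3 => f x) (volume.restrict Ω) :=
        integrableOn_const hvt (by simp)
      rw [integral_sub hi0 hfint, setAverage_eq, setIntegral_const, smul_sub,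
        smul_smul, inv_mul_cancel₀, one_smul]
      exact (ENNReal.toReal_pos hv0 hvt).ne'
    rw [e, enorm_smul]
    have : ‖(volume.real Ω)⁻¹‖ₑ = (volume Ω)⁻¹ := by
      have hp : 0 < volume.real Ω := ENNReal.toReal_pos hv0 hvt
      rw [Real.enorm_eq_ofReal (by positivity), ENNReal.ofReal_inv_of_pos hp, ofReal_measureReal hvt]
    rw [this, ← mul_assoc, ENNReal.mul_inv_cancel hv0 hvt, one_mul]
    refine (enorm_integral_le_lintegral_enorm _).trans (le_of_eq ?_)
    refine lintegral_congr fun y => ?_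
    rw [← enorm_neg]; congr 1; abel
  have s1 : ENNReal.ofReal (r ^ 3) * (volume (ball (0:E3) 1) * ‖f x - ⨍ y in Ω, f y‖ₑ) ≤
      ENNReal.ofReal (r ^ 3) * ∫⁻ y in Ω, ENNReal.ofReal ‖y - x‖ ^ (-(3 - θ)) *
       (ENNReal.ofReal (8 * ϱ ^ (1 - θ)) * ‖fderiv ℝ f y‖ₑ) := by
    rw [← mul_assoc, ← hvol]
    refine avg.trans (rp.trans ?_)
    rw [show (2 * r) ^ 3 / 3 = r ^ 3 * (8/3) by ring, ENNReal.ofReal_mul (by positivity), mul_assoc]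
    refine mul_le_mul' le_rfl ?_
    rw [← lintegral_const_mul _ (by fun_prop)]
    refine setLIntegral_mono' hΩm fun y hy => ?_
    have := ker_cmp ‖y - x‖ (3 * ϱ) 2 (3 - θ) (norm_nonneg _) (by positivity)
      ((hd y hy).trans hr2) (by linarith) (by linarith)
    refine (mul_le_mul' le_rfl (mul_le_mul' le_rfl this)).trans ?_
    have h3 : 8/3 * (3 * ϱ) ^ (3 - θ - 2) ≤ 8 * ϱ ^ (1 - θ) := by
      rw [Real.mul_rpow (by norm_num) hϱ.le, show 3 - θ - 2 = 1 - θ by ring]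
      have : (3:ℝ) ^ (1 - θ) ≤ 3 ^ (1:ℝ) := Real.rpow_le_rpow_of_exponent_le (by norm_num) (by linarith)
      rw [Real.rpow_one] at this
      have := mul_le_mul_of_nonneg_right this (by positivity : 0 ≤ ϱ ^ (1 - θ))
      linarith
    have h4 := ENNReal.ofReal_le_ofReal h3
    rw [ENNReal.ofReal_mul (by norm_num)] at h4
    calc _ = (ENNReal.ofReal (8/3) * ENNReal.ofReal ((3 * ϱ) ^ (3 - θ - 2))) *
          (ENNReal.ofReal ‖y - x‖ ^ (-(3 - θ)) * ‖fderiv ℝ f y‖ₑ) := by ring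
      _ ≤ _ := mul_le_mul' h4 le_rfl
      _ = _ := by ring
  have hR3 : 0 < r ^ 3 := by positivity
  refine ((ENNReal.mul_le_mul_iff_right (by simpa using hR3) ENNReal.ofReal_ne_top).1 s1).trans ?_
  rw [← lintegral_indicator hΩm]
  refine lintegral_mono fun y => ?_
  by_cases hy : y ∈ Ω
  · simp [indicator_of_mem hy]
  · simp [indicator_of_notMem hy]

lemma fin_lint (r : ℝ) (h : E3 → ℝ≥0∞) (H : E3 → ℝ) (hH : Continuous H) (hh : ∀ x, h x = ENNReal.ofReal (H x)) :
    ∫⁻ x in ball (0:E3) r, h x ≠ ∞ := by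
  obtain ⟨M, hM⟩ := (isCompact_closedBall (0:E3) r).exists_bound_of_continuousOn hH.continuousOn
  refine ne_of_lt ?_
  calc ∫⁻ x in ball (0:E3) r, h x ≤ ∫⁻ x in ball (0:E3) r, ENNReal.ofReal M := by
        refine setLIntegral_mono' measurableSet_ball fun x hx => ?_
        rw [hh]
        exact ENNReal.ofReal_le_ofReal ((le_abs_self _).trans (hM x (ball_subset_closedBall hx)))
    _ < ∞ := by
        rw [setLIntegral_const]
        exact ENNReal.mul_lt_top ENNReal.ofReal_lt_top measure_ball_lt_top

lemma exists_g (θ : ℝ) (h1 : θ ≤ 1) (h0 : 0 < θ) (ϱ : ℝ) (hϱ : 0 < ϱ)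
    (f : E3 → E3) (hf : ContDiff ℝ 1 f) (c : E3) (hc : c = ⨍ y in ball (0:E3) (Real.sqrt 2 * ϱ), f y)
    (hN : ∫⁻ y in ball (0:E3) (Real.sqrt 2 * ϱ), ‖f y - c‖ₑ ^ 2 ≠ 0) :
    ∃ g : E3 → ℝ≥0∞, Measurable g ∧
    (∀ x ∈ ball (0:E3) ϱ, ‖f x - c‖ₑ ≤ ∫⁻ y, ENNReal.ofReal ‖y - x‖ ^ (-(3 - θ)) * g y) ∧
    ∫⁻ y, g y ^ 2 ≤ (volume (ball (0:E3) 1))⁻¹ ^ 2 * 1024 *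
      ((∫⁻ y in ball (0:E3) (Real.sqrt 2 * ϱ), ‖fderiv ℝ f y‖ₑ ^ 2) ^ θ *
      (∫⁻ y in ball (0:E3) (Real.sqrt 2 * ϱ), ‖f y - c‖ₑ ^ 2) ^ (1 - θ)) := by
  have hfm : Measurable f := hf.continuous.measurable
  have hdc : Continuous (fderiv ℝ f) := hf.continuous_fderiv (by norm_num)
  have hdm : Measurable (fderiv ℝ f) := hdc.measurable
  have hfc : Continuous f := hf.continuous
  set Ω := ball (0:E3) (Real.sqrt 2 * ϱ) with hΩ
  have hΩm : MeasurableSet Ω := measurableSet_ball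
  set κ := volume (ball (0:E3) 1) with hκ
  have hκ0 : κ ≠ 0 := (measure_ball_pos _ _ one_pos).ne'
  have hκt : κ ≠ ∞ := measure_ball_lt_top.ne
  have hDt : ∫⁻ y in Ω, ‖fderiv ℝ f y‖ₑ ^ 2 ≠ ∞ :=
    fin_lint _ _ (fun y => ‖fderiv ℝ f y‖ ^ 2) (by fun_prop) fun x => by
      rw [ENNReal.ofReal_pow (norm_nonneg _), ofReal_norm]
  have hNt : ∫⁻ y in Ω, ‖f y - c‖ₑ ^ 2 ≠ ∞ :=
    fin_lint _ _ (fun y => ‖f y - c‖ ^ 2) (by fun_prop) fun x => by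
      rw [ENNReal.ofReal_pow (norm_nonneg _), ofReal_norm]
  set D2 := ∫⁻ y in Ω, ‖fderiv ℝ f y‖ₑ ^ 2 with hD2
  set N2 := ∫⁻ y in Ω, ‖f y - c‖ₑ ^ 2 with hN2
  have key : ∀ (G : E3 → ℝ≥0∞), Measurable G →
      (∀ x ∈ ball (0:E3) ϱ, κ * ‖f x - c‖ₑ ≤ ∫⁻ y, ENNReal.ofReal ‖y - x‖ ^ (-(3 - θ)) * G y) →
      ∫⁻ y, G y ^ 2 ≤ 1024 * (D2 ^ θ * N2 ^ (1 - θ)) →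
      ∃ g : E3 → ℝ≥0∞, Measurable g ∧
      (∀ x ∈ ball (0:E3) ϱ, ‖f x - c‖ₑ ≤ ∫⁻ y, ENNReal.ofReal ‖y - x‖ ^ (-(3 - θ)) * g y) ∧
      ∫⁻ y, g y ^ 2 ≤ κ⁻¹ ^ 2 * 1024 * (D2 ^ θ * N2 ^ (1 - θ)) := by
    intro G hG hb hs
    refine ⟨fun y => κ⁻¹ * G y, by fun_prop, fun x hx => ?_, ?_⟩
    · have := mul_le_mul' (le_refl κ⁻¹) (hb x hx)
      rw [← mul_assoc, ENNReal.inv_mul_cancel hκ0 hκt, one_mul,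
        ← lintegral_const_mul _ (by fun_prop)] at this
      refine this.trans (le_of_eq (lintegral_congr fun y => by ring))
    · simp only [mul_pow]
      rw [lintegral_const_mul _ (by fun_prop), mul_assoc]
      exact mul_le_mul' le_rfl hs
  set d := D2.toReal with hd
  set n := N2.toReal with hn
  have eD : D2 = ENNReal.ofReal d := (ENNReal.ofReal_toReal hDt).symm
  have eN : N2 = ENNReal.ofReal n := (ENNReal.ofReal_toReal hNt).symm
  have hd0 : 0 ≤ d := ENNReal.toReal_nonneg
  have hn0 : 0 < n := ENNReal.toReal_pos hN hNt
  have eR : D2 ^ θ * N2 ^ (1 - θ) = ENNReal.ofReal (d ^ θ * n ^ (1 - θ)) := by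
    rw [eD, eN, ENNReal.ofReal_rpow_of_nonneg hd0 h0.le, ENNReal.ofReal_rpow_of_pos hn0,
      ENNReal.ofReal_mul (by positivity)]
  rw [eR] at key ⊢
  by_cases hcase : ϱ ^ 2 * d ≤ 16 * n
  · refine key (Ω.indicator (fun y => ENNReal.ofReal (8 * ϱ ^ (1 - θ)) * ‖fderiv ℝ f y‖ₑ))
      (Measurable.indicator (by fun_prop) hΩm) (fun x hx => ?_) ?_
    · rw [hc]; exact caseA_pt θ h1 h0 ϱ hϱ x hx f hf
    · have e1 : ∀ y, Ω.indicator (fun y => ENNReal.ofReal (8 * ϱ ^ (1 - θ)) * ‖fderiv ℝ f y‖ₑ) y ^ 2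
          = Ω.indicator (fun y => ENNReal.ofReal ((8 * ϱ ^ (1 - θ)) ^ 2) * ‖fderiv ℝ f y‖ₑ ^ 2) y := by
        intro y
        by_cases hy : y ∈ Ω
        · simp only [indicator_of_mem hy]; rw [mul_pow, ENNReal.ofReal_pow (by positivity)]
        · simp [indicator_of_notMem hy]
      simp only [e1]
      rw [lintegral_indicator hΩm, lintegral_const_mul _ (by fun_prop), ← hD2, eD,
        ← ENNReal.ofReal_mul (by positivity),
        show (1024:ℝ≥0∞) = ENNReal.ofReal 1024 by simp, ← ENNReal.ofReal_mul (by norm_num)]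
      apply ENNReal.ofReal_le_ofReal
      rcases hd0.eq_or_lt with hd1 | hd1
      · rw [← hd1, mul_zero]; positivity
      have e2 : (8 * ϱ ^ (1 - θ)) ^ 2 * d = 64 * ((ϱ ^ 2 * d) ^ (1 - θ) * d ^ θ) := by
        rw [Real.mul_rpow (by positivity) hd0, mul_assoc ((ϱ ^ 2) ^ (1 - θ)), ← Real.rpow_add hd1,
          ← Real.rpow_natCast ϱ 2, ← Real.rpow_mul hϱ.le, mul_pow, ← Real.rpow_natCast (ϱ ^ (1 - θ)) 2,
          ← Real.rpow_mul hϱ.le]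
        norm_num [mul_comm]
        ring
      have e3 : (ϱ ^ 2 * d) ^ (1 - θ) ≤ 16 * n ^ (1 - θ) := by
        refine (Real.rpow_le_rpow (by positivity) hcase (by linarith)).trans ?_
        rw [Real.mul_rpow (by norm_num) hn0.le]
        gcongr
        exact (Real.rpow_le_rpow_of_exponent_le (by norm_num) (by linarith)).trans_eq (Real.rpow_one _)
      rw [e2]
      have := mul_le_mul_of_nonneg_right e3 (by positivity : 0 ≤ d ^ θ)
      linarith
  · push Not at hcase
    have hdp : 0 < d := by
      by_contra hneg
      have : d = 0 := by linarith
      rw [this] at hcase; linarith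
    set R := Real.sqrt (n / d) with hR
    have hRp : 0 < R := Real.sqrt_pos.2 (by positivity)
    have hR2 : R ^ 2 = n / d := Real.sq_sqrt (by positivity)
    have hRϱ : R ≤ ϱ / 4 := by
      have : R ^ 2 ≤ (ϱ / 4) ^ 2 := by
        rw [hR2, div_le_iff₀ hdp]; linarith
      exact (sq_le_sq₀ hRp.le (by positivity)).1 this
    have hs : 5/4 ≤ Real.sqrt 2 := Real.le_sqrt_of_sq_le (by norm_num)
    refine key (Ω.indicator (fun y => ENNReal.ofReal (R ^ (1 - θ)) * ‖fderiv ℝ f y‖ₑ +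
        ENNReal.ofReal (R ^ (-θ)) * ‖f y - c‖ₑ))
      (Measurable.indicator (by fun_prop) hΩm) (fun x hx => ?_) ?_
    · refine caseB_pt θ h0 h1 Ω hΩm R hRp x (fun y hy => ?_) f hf c
      rw [hΩ, mem_ball_zero_iff]
      have a := mem_ball_iff_norm.1 hy
      have b := mem_ball_zero_iff.1 hx
      have : ‖y‖ ≤ ‖y - x‖ + ‖x‖ := by simpa using norm_add_le (y - x) x
      nlinarith
    · have e1 : ∀ y, Ω.indicator (fun y => ENNReal.ofReal (R ^ (1 - θ)) * ‖fderiv ℝ f y‖ₑ +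
          ENNReal.ofReal (R ^ (-θ)) * ‖f y - c‖ₑ) y ^ 2
          ≤ Ω.indicator (fun y => 2 * ENNReal.ofReal ((R ^ (1 - θ)) ^ 2) * ‖fderiv ℝ f y‖ₑ ^ 2 +
            2 * ENNReal.ofReal ((R ^ (-θ)) ^ 2) * ‖f y - c‖ₑ ^ 2) y := by
        intro y
        by_cases hy : y ∈ Ω
        · simp only [indicator_of_mem hy]
          rw [ENNReal.ofReal_pow (by positivity), ENNReal.ofReal_pow (by positivity)]
          have := ENNReal.rpow_add_le_mul_rpow_add_rpow (ENNReal.ofReal (R ^ (1 - θ)) * ‖fderiv ℝ f y‖ₑ)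
            (ENNReal.ofReal (R ^ (-θ)) * ‖f y - c‖ₑ) (p := 2) (by norm_num)
          norm_num at this
          refine this.trans (le_of_eq ?_)
          ring
        · simp [indicator_of_notMem hy]
      refine (lintegral_mono e1).trans ?_
      rw [lintegral_indicator hΩm, lintegral_add_left (by fun_prop), lintegral_const_mul _ (by fun_prop),
        lintegral_const_mul _ (by fun_prop), ← hD2, ← hN2, eD, eN,
        show (1024:ℝ≥0∞) = ENNReal.ofReal 1024 by simp, show (2:ℝ≥0∞) = ENNReal.ofReal 2 by simp,
        ← ENNReal.ofReal_mul (by positivity), ← ENNReal.ofReal_mul (by positivity),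
        ← ENNReal.ofReal_mul (by positivity), ← ENNReal.ofReal_mul (by positivity),
        ← ENNReal.ofReal_mul (by positivity), ← ENNReal.ofReal_add (by positivity) (by positivity)]
      apply ENNReal.ofReal_le_ofReal
      have sw : ∀ s : ℝ, (R ^ s) ^ 2 = (n / d) ^ s := by
        intro s
        rw [← hR2, ← Real.rpow_natCast, ← Real.rpow_natCast, ← Real.rpow_mul hRp.le,
          ← Real.rpow_mul hRp.le, mul_comm]
      have f1 : (R ^ (1 - θ)) ^ 2 * d = d ^ θ * n ^ (1 - θ) := by
        rw [sw, Real.div_rpow hn0.le hdp.le, Real.rpow_sub hdp, Real.rpow_one]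
        field_simp
      have f2 : (R ^ (-θ)) ^ 2 * n = d ^ θ * n ^ (1 - θ) := by
        rw [sw, Real.rpow_neg (by positivity), Real.div_rpow hn0.le hdp.le, Real.rpow_sub hn0, Real.rpow_one]
        field_simp
      have : 0 ≤ d ^ θ * n ^ (1 - θ) := by positivity
      rw [mul_assoc, mul_assoc, f1, f2]
      linarith

lemma slice (q1 q2 q3 : ℝ) (hq1 : 1 < q1) (hq2 : 1 < q2) (hq3 : 1 < q3) (θ : ℝ)
    (hθ : θ = (1/q1+1/q2+1/q3)/2) (h1 : θ ≤ 1) :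
    ∃ C : ℝ, 0 < C ∧ ∀ (ϱ : ℝ) (_ : 0 < ϱ) (f : E3 → E3) (_ : ContDiff ℝ 1 f) (c : E3)
      (_ : c = ⨍ y in ball (0:E3) (Real.sqrt 2 * ϱ), f y),
      ∫⁻ x in ball (0:E3) ϱ, ‖f x - c‖ₑ ^ 3 ≤ ENNReal.ofReal C *
        anisoNorm q1 q2 q3 (ball (0:E3) ϱ) (fun x => ‖f x - c‖) *
      ((∫⁻ y in ball (0:E3) (Real.sqrt 2 * ϱ), ‖fderiv ℝ f y‖ₑ ^ 2) ^ θ *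
      (∫⁻ y in ball (0:E3) (Real.sqrt 2 * ϱ), ‖f y - c‖ₑ ^ 2) ^ (1 - θ)) := by
  obtain ⟨C, hC, H⟩ := slice_core q1 q2 q3 hq1 hq2 hq3
  have h0 : 0 < θ := by rw [hθ]; positivity
  set κ := volume (ball (0:E3) 1) with hκ
  have hκ0 : κ ≠ 0 := (measure_ball_pos _ _ one_pos).ne'
  have hκt : κ ≠ ∞ := measure_ball_lt_top.ne
  have hκp : 0 < κ.toReal := ENNReal.toReal_pos hκ0 hκt
  have hK : κ⁻¹ ^ 2 * 1024 = ENNReal.ofReal (κ.toReal⁻¹ ^ 2 * 1024) := by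
    rw [ENNReal.ofReal_mul (by positivity), ENNReal.ofReal_pow (by positivity),
      ENNReal.ofReal_inv_of_pos hκp, ENNReal.ofReal_toReal hκt]
    simp
  refine ⟨C * (κ.toReal⁻¹ ^ 2 * 1024), by positivity, fun ϱ hϱ f hf c hc => ?_⟩
  have hfm : Measurable f := hf.continuous.measurable
  by_cases hN : ∫⁻ y in ball (0:E3) (Real.sqrt 2 * ϱ), ‖f y - c‖ₑ ^ 2 = 0
  · have hs1 : 1 ≤ Real.sqrt 2 := by rw [Real.one_le_sqrt]; norm_num
    have hsub : ball (0:E3) ϱ ⊆ ball (0:E3) (Real.sqrt 2 * ϱ) := ball_subset_ball (by nlinarith)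
    have : ∫⁻ x in ball (0:E3) ϱ, ‖f x - c‖ₑ ^ 3 = 0 := by
      rw [lintegral_eq_zero_iff (by fun_prop)] at hN ⊢
      have := ae_restrict_of_ae_restrict_of_subset hsub hN
      filter_upwards [this] with x hx
      simpa using hx
    rw [this]; exact zero_le
  · obtain ⟨g, hg, hb, hs⟩ := exists_g θ h1 h0 ϱ hϱ f hf c hc hN
    refine (H _ measurableSet_ball (fun x => f x - c) (by fun_prop) g hg ?_).trans ?_
    · rw [← hθ]; exact hb
    · refine (mul_le_mul' le_rfl hs).trans (le_of_eq ?_)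
      rw [hK, ENNReal.ofReal_mul hC.le]; ring

end CubeAux

namespace CubeAux

lemma mix_meas (q1 q2 q3 : ℝ) (F : ℝ → ℝ → ℝ → ℝ → ℝ≥0∞)
    (hF : Measurable (fun z : ((ℝ × ℝ) × ℝ) × ℝ => F z.1.1.1 z.2 z.1.2 z.1.1.2)) :
    Measurable (fun t => mix q1 q2 q3 (F t)) := by
  unfold mix
  have m1 : Measurable (fun z : (ℝ × ℝ) × ℝ => ∫⁻ x1, F z.1.1 x1 z.2 z.1.2 ^ q1) :=
    Measurable.lintegral_prod_right' (f := fun z : ((ℝ × ℝ) × ℝ) × ℝ =>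
      F z.1.1.1 z.2 z.1.2 z.1.1.2 ^ q1) (hF.pow_const _)
  have m2 : Measurable (fun z : ℝ × ℝ => ∫⁻ x2, ((∫⁻ x1, F z.1 x1 x2 z.2 ^ q1) ^ (1/q1)) ^ q2) :=
    Measurable.lintegral_prod_right' (f := fun z : (ℝ × ℝ) × ℝ =>
      ((∫⁻ x1, F z.1.1 x1 z.2 z.1.2 ^ q1) ^ (1/q1)) ^ q2) ((m1.pow_const _).pow_const _)
  refine Measurable.pow_const ?_ _
  exact Measurable.lintegral_prod_right' (f := fun z : ℝ × ℝ =>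
      ((∫⁻ x2, ((∫⁻ x1, F z.1 x1 x2 z.2 ^ q1) ^ (1/q1)) ^ q2) ^ (1/q2)) ^ q3)
        ((m2.pow_const _).pow_const _)

lemma avg_meas (u : E3 → ℝ → E3) (hu : Measurable (Function.uncurry u)) (s : Set E3) :
    Measurable (fun t => ⨍ y in s, u y t) := by
  simp only [setAverage_eq]
  have : StronglyMeasurable (fun z : ℝ × E3 => u z.2 z.1) :=
    (hu.comp measurable_swap).stronglyMeasurable
  have h2 : Measurable (fun t => ∫ y in s, u y t) :=
    (StronglyMeasurable.integral_prod_right' (ν := volume.restrict s) this).measurable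
  fun_prop

lemma fderiv_meas (u : E3 → ℝ → E3) (hu : Measurable (Function.uncurry u))
    (hc : ∀ t : ℝ, ContDiff ℝ 1 (fun x => u x t)) :
    Measurable (fun z : ℝ × E3 => fderiv ℝ (fun y => u y z.1) z.2) := by
  have hap : ∀ e : E3, Measurable (fun z : ℝ × E3 => fderiv ℝ (fun y => u y z.1) z.2 e) := by
    intro e
    refine measurable_of_tendsto_metrizable (f := fun (n : ℕ) (z : ℝ × E3) =>
      (n : ℝ) • (u (z.2 + (n:ℝ)⁻¹ • e) z.1 - u z.2 z.1)) (fun n => ?_) ?_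
    · have a : Measurable (fun z : ℝ × E3 => u (z.2 + (n:ℝ)⁻¹ • e) z.1) :=
        hu.comp (by fun_prop : Measurable fun z : ℝ × E3 => (z.2 + (n:ℝ)⁻¹ • e, z.1))
      have b : Measurable (fun z : ℝ × E3 => u z.2 z.1) := hu.comp measurable_swap
      have := a.sub b
      exact Measurable.const_smul this (n:ℝ)
    · rw [tendsto_pi_nhds]
      intro z
      have hd : HasFDerivAt (fun y => u y z.1) (fderiv ℝ (fun y => u y z.1) z.2) z.2 :=
        ((hc z.1).differentiable (by norm_num)).differentiableAt.hasFDerivAt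
      exact hd.lim e (c := fun n : ℕ => (n:ℝ)) (l := atTop) (by
        simpa using tendsto_natCast_atTop_atTop)
  have e1 : ∀ z : ℝ × E3, fderiv ℝ (fun y => u y z.1) z.2 = ∑ i : Fin 3,
      (EuclideanSpace.proj i : E3 →L[ℝ] ℝ).smulRight
        (fderiv ℝ (fun y => u y z.1) z.2 (EuclideanSpace.single i 1)) := by
    intro z
    ext1 v
    have hv : v = ∑ i : Fin 3, v i • EuclideanSpace.single i (1:ℝ) := by
      ext j; simp [Finset.sum_apply, Pi.single_apply]
    conv_lhs => rw [hv]
    simp [map_sum]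
  rw [funext e1]
  refine Finset.measurable_sum _ fun i _ => ?_
  exact ((ContinuousLinearMap.smulRightL ℝ E3 E3 (EuclideanSpace.proj i)).continuous.measurable).comp
    (hap _)

lemma main (p : ℝ≥0∞) (q1 q2 q3 : ℝ) (hp : 1 ≤ p)
    (hq1 : 1 < q1) (hq2 : 1 < q2) (hq3 : 1 < q3)
    (hpq : 2 / p.toReal + (1/q1 + 1/q2 + 1/q3) = 2) :
    ∃ C : ℝ, 0 < C ∧
      ∀ (ϱ : ℝ), 0 < ϱ → ∀ u : E3 → ℝ → E3,
        Measurable (Function.uncurry u) →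
        (∀ t : ℝ, ContDiff ℝ (⊤ : ℕ∞) (fun x => u x t)) →
        (∫⁻ t in Ioo (-(ϱ^2)) 0, ∫⁻ x in ball (0 : E3) ϱ,
            ((‖u x t - ⨍ y in ball (0 : E3) (Real.sqrt 2 * ϱ), u y t‖₊ : ℝ≥0∞)) ^ 3)
          ≤ ENNReal.ofReal C
              * mixedNorm p q1 q2 q3 ϱ
                  (fun x t => ‖u x t - ⨍ y in ball (0 : E3) (Real.sqrt 2 * ϱ), u y t‖)
              * ((∫⁻ t in Ioo (-((Real.sqrt 2 * ϱ)^2)) 0,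
                    ∫⁻ x in ball (0 : E3) (Real.sqrt 2 * ϱ),
                      (ENNReal.ofReal ‖fderiv ℝ (fun y => u y t) x‖) ^ 2) ^ ((1:ℝ)/2))
                  ^ (2 - 2 / p.toReal)
              * (essSup (fun t => l2On (ball (0 : E3) (Real.sqrt 2 * ϱ))
                      (fun x => ‖u x t - ⨍ y in ball (0 : E3) (Real.sqrt 2 * ϱ), u y t‖))
                    (volume.restrict (Ioo (-((Real.sqrt 2 * ϱ)^2)) 0)))
                  ^ (2 / p.toReal) := by
  set θ := (1/q1 + 1/q2 + 1/q3) / 2 with hθ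
  have h2p : 2 / p.toReal = 2 * (1 - θ) := by rw [hθ]; linarith
  have hpt : 0 ≤ 2 / p.toReal := by positivity
  have h1 : θ ≤ 1 := by linarith
  have h0 : 0 < θ := by rw [hθ]; positivity
  obtain ⟨C, hC, H⟩ := slice q1 q2 q3 hq1 hq2 hq3 θ hθ h1
  refine ⟨C, hC, fun ϱ hϱ u hu hcd => ?_⟩
  have hcd1 : ∀ t : ℝ, ContDiff ℝ 1 (fun x => u x t) := fun t => (hcd t).of_le (by exact_mod_cast le_top)
  set Ω := ball (0 : E3) (Real.sqrt 2 * ϱ) with hΩ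
  set c : ℝ → E3 := fun t => ⨍ y in Ω, u y t with hc
  have hcm : Measurable c := avg_meas u hu Ω
  set a : ℝ → ℝ≥0∞ := fun t => anisoNorm q1 q2 q3 (ball (0:E3) ϱ) (fun x => ‖u x t - c t‖) with ha
  set D : ℝ → ℝ≥0∞ := fun t => ∫⁻ x in Ω, ‖fderiv ℝ (fun y => u y t) x‖ₑ ^ 2 with hD
  set M := essSup (fun t => l2On Ω (fun x => ‖u x t - c t‖))
    (volume.restrict (Ioo (-((Real.sqrt 2 * ϱ)^2)) 0)) with hM
  have hs1 : 1 ≤ Real.sqrt 2 := by rw [Real.one_le_sqrt]; norm_num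
  have hsub : Ioo (-(ϱ^2)) 0 ⊆ Ioo (-((Real.sqrt 2 * ϱ)^2)) (0:ℝ) := by
    apply Ioo_subset_Ioo_left
    have : ϱ ^ 2 ≤ (Real.sqrt 2 * ϱ) ^ 2 := by
      apply pow_le_pow_left₀ hϱ.le; nlinarith
    linarith
  have hDm : Measurable D := by
    have := fderiv_meas u hu hcd1
    exact Measurable.lintegral_prod_right' (ν := volume.restrict Ω) (f := fun z : ℝ × E3 =>
      ‖fderiv ℝ (fun y => u y z.1) z.2‖ₑ ^ 2) (this.enorm.pow_const 2)
  have ham : Measurable a := by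
    have e : a = fun t => mix q1 q2 q3 ((fun (t x1 x2 x3 : ℝ) =>
        (ball (0:E3) ϱ).indicator (fun x => ‖u x t - c t‖ₑ) (pt3 x1 x2 x3)) t) := by
      funext t; exact aniso_eq q1 q2 q3 _ _
    rw [e]
    apply mix_meas
    have hp3 : Measurable (fun z : ((ℝ × ℝ) × ℝ) × ℝ => pt3 z.2 z.1.2 z.1.1.2) :=
      pt3_measurable.comp (by fun_prop : Measurable fun z : ((ℝ × ℝ) × ℝ) × ℝ => (z.2, z.1.2, z.1.1.2))
    have hu3 : Measurable (fun z : ((ℝ × ℝ) × ℝ) × ℝ => u (pt3 z.2 z.1.2 z.1.1.2) z.1.1.1) :=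
      hu.comp (hp3.prodMk (by fun_prop : Measurable fun z : ((ℝ × ℝ) × ℝ) × ℝ => z.1.1.1))
    have hm : Measurable (fun z : ((ℝ × ℝ) × ℝ) × ℝ =>
        ‖u (pt3 z.2 z.1.2 z.1.1.2) z.1.1.1 - c z.1.1.1‖ₑ) := by fun_prop
    exact hm.indicator (hp3 measurableSet_ball)
  have eD : (∫⁻ t in Ioo (-((Real.sqrt 2 * ϱ)^2)) 0, ∫⁻ x in Ω,
      (ENNReal.ofReal ‖fderiv ℝ (fun y => u y t) x‖) ^ 2) =
      ∫⁻ t in Ioo (-((Real.sqrt 2 * ϱ)^2)) 0, D t := by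
    simp only [ofReal_norm, hD]
  have eD2 : ((∫⁻ t in Ioo (-((Real.sqrt 2 * ϱ)^2)) 0, D t) ^ ((1:ℝ)/2)) ^ (2 - 2 / p.toReal)
      = (∫⁻ t in Ioo (-((Real.sqrt 2 * ϱ)^2)) 0, D t) ^ θ := by
    rw [← ENNReal.rpow_mul]; congr 1; rw [h2p]; ring
  rw [eD, eD2]
  have hDle : ∫⁻ t in Ioo (-(ϱ^2)) 0, D t ≤ ∫⁻ t in Ioo (-((Real.sqrt 2 * ϱ)^2)) 0, D t :=
    lintegral_mono_set hsub
  -- slicewise bound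
  have hN : ∀ᵐ t ∂(volume.restrict (Ioo (-(ϱ^2)) (0:ℝ))),
      (∫⁻ y in Ω, ‖u y t - c t‖ₑ ^ 2) ^ (1 - θ) ≤ M ^ (2 / p.toReal) := by
    have h := ENNReal.ae_le_essSup (μ := volume.restrict (Ioo (-((Real.sqrt 2 * ϱ)^2)) 0))
      (fun t => l2On Ω (fun x => ‖u x t - c t‖))
    filter_upwards [ae_restrict_of_ae_restrict_of_subset hsub h] with t ht
    have h3 := ENNReal.rpow_le_rpow ht hpt
    refine le_trans (le_of_eq ?_) h3
    unfold l2On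
    simp only [abs_norm, ofReal_norm]
    rw [← ENNReal.rpow_mul, h2p]
    congr 1; ring
  have hslice : ∫⁻ t in Ioo (-(ϱ^2)) 0, ∫⁻ x in ball (0 : E3) ϱ, ((‖u x t - c t‖₊ : ℝ≥0∞)) ^ 3 ≤
      ∫⁻ t in Ioo (-(ϱ^2)) 0, (ENNReal.ofReal C * M ^ (2 / p.toReal)) * (a t * D t ^ θ) := by
    refine lintegral_mono_ae ?_
    filter_upwards [hN] with t ht
    refine (H ϱ hϱ (fun x => u x t) (hcd1 t) (c t) rfl).trans ?_
    calc _ ≤ ENNReal.ofReal C * a t * (D t ^ θ * M ^ (2 / p.toReal)) :=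
          mul_le_mul' le_rfl (mul_le_mul' le_rfl ht)
      _ = _ := by ring
  refine hslice.trans ?_
  rw [lintegral_const_mul _ (by fun_prop)]
  have fin : ∫⁻ t in Ioo (-(ϱ^2)) 0, a t * D t ^ θ ≤
      mixedNorm p q1 q2 q3 ϱ (fun x t => ‖u x t - c t‖) *
        (∫⁻ t in Ioo (-((Real.sqrt 2 * ϱ)^2)) 0, D t) ^ θ := by
    unfold mixedNorm
    by_cases hpi : p = ∞
    · rw [if_pos hpi]
      have hθ1 : θ = 1 := by
        rw [hpi] at h2p; simp at h2p; linarith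
      rw [hθ1]
      simp only [ENNReal.rpow_one]
      have h := ENNReal.ae_le_essSup (μ := volume.restrict (Ioo (-(ϱ^2)) 0)) a
      calc ∫⁻ t in Ioo (-(ϱ^2)) 0, a t * D t
          ≤ ∫⁻ t in Ioo (-(ϱ^2)) 0, essSup a (volume.restrict (Ioo (-(ϱ^2)) 0)) * D t := by
            refine lintegral_mono_ae ?_
            filter_upwards [h] with t ht
            exact mul_le_mul' ht le_rfl
        _ = essSup a (volume.restrict (Ioo (-(ϱ^2)) 0)) * ∫⁻ t in Ioo (-(ϱ^2)) 0, D t :=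
            lintegral_const_mul _ hDm
        _ ≤ _ := mul_le_mul' le_rfl hDle
    · rw [if_neg hpi]
      have hpos : 0 < p.toReal := ENNReal.toReal_pos (by positivity) hpi
      have hθp : θ = 1 - 1 / p.toReal := by
        have : 2 / p.toReal = 2 * (1 / p.toReal) := by ring
        linarith
      have hp1 : 1 < p.toReal := by
        have : 1 / p.toReal < 1 := by linarith
        rwa [div_lt_one hpos] at this
      have hconj := Real.HolderConjugate.conjExponent hp1
      have hθ2 : 1 / p.toReal.conjExponent = θ := by
        have := hconj.inv_add_inv_eq_one
        rw [hθp, one_div, one_div]; linarith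
      have hol := ENNReal.lintegral_mul_le_Lp_mul_Lq (volume.restrict (Ioo (-(ϱ^2)) (0:ℝ))) hconj
        (f := a) (g := fun t => D t ^ θ) ham.aemeasurable (by fun_prop)
      refine hol.trans (mul_le_mul' le_rfl ?_)
      rw [hθ2]
      refine ENNReal.rpow_le_rpow (le_trans (le_of_eq ?_) hDle) h0.le
      refine lintegral_congr fun t => ?_
      rw [← ENNReal.rpow_mul, ← hθ2, one_div, inv_mul_cancel₀ hconj.symm.ne_zero, ENNReal.rpow_one]
  refine (mul_le_mul' le_rfl fin).trans (le_of_eq ?_)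
  ring

end CubeAux

/-- The key estimate (3.2): with `2/p + 1/q̄ = 2`, `q_j > 1`, and `v = u − ū_{√2ϱ}`:
`∬_{Q(ϱ)} |v|³ ≤ C ‖v‖_{L^p_t L^{q⃗}_x(Q(ϱ))} ‖∇u‖_{L²(Q(√2ϱ))}^{2−2/p}
  ‖v‖_{L^∞_t L²_x(Q(√2ϱ))}^{2/p}`. -/
theorem cube_estimate
    (p : ℝ≥0∞) (q1 q2 q3 : ℝ) (hp : 1 ≤ p)
    (hq1 : 1 < q1) (hq2 : 1 < q2) (hq3 : 1 < q3)
    (hpq : 2 / p.toReal + (1/q1 + 1/q2 + 1/q3) = 2) :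
    ∃ C : ℝ, 0 < C ∧
      ∀ (ϱ : ℝ), 0 < ϱ → ∀ u : E3 → ℝ → E3,
        Measurable (Function.uncurry u) →
        (∀ t : ℝ, ContDiff ℝ (⊤ : ℕ∞) (fun x => u x t)) →
        (∫⁻ t in Ioo (-(ϱ^2)) 0, ∫⁻ x in ball (0 : E3) ϱ,
            ((‖u x t - ⨍ y in ball (0 : E3) (Real.sqrt 2 * ϱ), u y t‖₊ : ℝ≥0∞)) ^ 3)
          ≤ ENNReal.ofReal C
              * mixedNorm p q1 q2 q3 ϱ
                  (fun x t => ‖u x t - ⨍ y in ball (0 : E3) (Real.sqrt 2 * ϱ), u y t‖)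
              * ((∫⁻ t in Ioo (-((Real.sqrt 2 * ϱ)^2)) 0,
                    ∫⁻ x in ball (0 : E3) (Real.sqrt 2 * ϱ),
                      (ENNReal.ofReal ‖fderiv ℝ (fun y => u y t) x‖) ^ 2) ^ ((1:ℝ)/2))
                  ^ (2 - 2 / p.toReal)
              * (essSup (fun t => l2On (ball (0 : E3) (Real.sqrt 2 * ϱ))
                      (fun x => ‖u x t - ⨍ y in ball (0 : E3) (Real.sqrt 2 * ϱ), u y t‖))
                    (volume.restrict (Ioo (-((Real.sqrt 2 * ϱ)^2)) 0)))
                  ^ (2 / p.toReal) := by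
  exact CubeAux.main p q1 q2 q3 hp hq1 hq2 hq3 hpq
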